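/- arXiv:math/0311266 — 3 statements merged into one kernel-verified Lean document; each statement's English description precedes it below -/
import Mathlib

section
/- (Reiner's appendix theorem, freeness form.) Let n ≥ 1, let k be a field, and let G be a subgroup of Equiv.Perm (Fin n). Let R be the Stanley–Reisner ring of the Boolean algebra B_n minus its bottom element: R = (MvPolynomial V k)/I, where V = {S : Finset (Fin n) // S.Nonempty} and I is the ideal generated by all products y_S·y_T with S and T incomparable (¬S ⊆ T and ¬T ⊆ S). G acts on R (induced by g•y_S = y_{g(S)}, which preserves I), and the elements θ_i = (image in R of Σ_{S : |S| = i} y_S), for i = 1,…,n, lie in the fixed subalgebra R^G; let Θ be the subalgebra of R^G generated over k by θ_1,…,θ_n. If R^G is a free Θ-module, then the invariant polynomial ring (MvPolynomial (Fin n) k)^G is a free module over the subalgebra E generated over k by the elementary symmetric polynomials e_1,…,e_n (MvPolynomial.esymm). Equivalently: if k[Δ(B_n)]^G is Cohen-Macaulay over k, then k[x_1,…,x_n]^G is Cohen-Macaulay over k. -/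
set_option synthInstance.maxHeartbeats 1000000
set_option maxHeartbeats 1000000


/-- Vertices of the order complex of `B_n` minus its bottom element:
the nonempty subsets of `{1,…,n}`. -/
abbrev SRVertex (n : ℕ) := { S : Finset (Fin n) // S.Nonempty }

/-- The Stanley–Reisner ideal: generated by the products `y_S * y_T` for
incomparable nonempty subsets `S, T`. -/
noncomputable def SRIdeal (n : ℕ) (k : Type) [CommRing k] :
    Ideal (MvPolynomial (SRVertex n) k) :=
  Ideal.span { q | ∃ S T : SRVertex n, ¬ (S.1 ⊆ T.1) ∧ ¬ (T.1 ⊆ S.1) ∧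
    q = MvPolynomial.X S * MvPolynomial.X T }

/-- The Stanley–Reisner ring of the Boolean algebra `B_n` minus its bottom
element. -/
abbrev SRRing (n : ℕ) (k : Type) [CommRing k] :=
  MvPolynomial (SRVertex n) k ⧸ SRIdeal n k

/-- The action of a permutation of `{1,…,n}` on the vertices, `S ↦ g(S)`. -/
def SRpermVertex (n : ℕ) (g : Equiv.Perm (Fin n)) (S : SRVertex n) : SRVertex n :=
  ⟨S.1.image g, S.2.image g⟩

lemma SRIdeal_le_comap (n : ℕ) (k : Type) [CommRing k] (g : Equiv.Perm (Fin n)) :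
    SRIdeal n k ≤ (SRIdeal n k).comap
      (MvPolynomial.rename (SRpermVertex n g)).toRingHom := by
  rw [SRIdeal, Ideal.span_le]
  rintro q ⟨S, T, hST, hTS, rfl⟩
  simp only [SetLike.mem_coe, Ideal.mem_comap, AlgHom.toRingHom_eq_coe,
    RingHom.coe_coe, map_mul, MvPolynomial.rename_X]
  apply Ideal.subset_span
  refine ⟨SRpermVertex n g S, SRpermVertex n g T, ?_, ?_, rfl⟩
  · intro h
    exact hST ((Finset.image_subset_image_iff (Equiv.injective g)).mp h)
  · intro h
    exact hTS ((Finset.image_subset_image_iff (Equiv.injective g)).mp h)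

/-- The induced action of a permutation `g ∈ S_n` on the Stanley–Reisner ring,
induced by `y_S ↦ y_{g(S)}`. -/
noncomputable def SRmap (n : ℕ) (k : Type) [CommRing k] (g : Equiv.Perm (Fin n)) :
    SRRing n k →+* SRRing n k :=
  Ideal.quotientMap (SRIdeal n k) (MvPolynomial.rename (SRpermVertex n g)).toRingHom
    (SRIdeal_le_comap n k g)

/-- The fixed-point subalgebra `R^G` of the Stanley–Reisner ring under a
subgroup `G ≤ S_n`. -/
noncomputable def SRinvariant (n : ℕ) (k : Type) [CommRing k]
    (G : Subgroup (Equiv.Perm (Fin n))) : Subalgebra k (SRRing n k) where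
  carrier := { r | ∀ g ∈ G, SRmap n k g r = r }
  add_mem' := by
    intro p q hp hq g hg
    rw [map_add, hp g hg, hq g hg]
  mul_mem' := by
    intro p q hp hq g hg
    rw [map_mul, hp g hg, hq g hg]
  algebraMap_mem' := by
    intro r g hg
    have h1 : (algebraMap k (SRRing n k)) r =
        Ideal.Quotient.mk (SRIdeal n k) (MvPolynomial.C r) := rfl
    rw [h1, SRmap, Ideal.quotientMap_mk]
    simp [MvPolynomial.rename_C]

/-- The element `θ_i`: the image in the Stanley–Reisner ring of the sum of the
variables `y_S` over all `S` with `|S| = i`. -/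
noncomputable def SRtheta (n : ℕ) (k : Type) [CommRing k] (i : ℕ) : SRRing n k :=
  Ideal.Quotient.mk (SRIdeal n k)
    (∑ S ∈ Finset.univ.filter (fun S : SRVertex n => S.1.card = i),
      MvPolynomial.X S)

/-- The subalgebra `Θ` of `R^G` generated over `k` by `θ_1, …, θ_n`. -/
noncomputable def SRthetaSubalgebra (n : ℕ) (k : Type) [CommRing k]
    (G : Subgroup (Equiv.Perm (Fin n))) : Subalgebra k (SRinvariant n k G) :=
  Algebra.adjoin k { a : SRinvariant n k G | ∃ i : ℕ, 1 ≤ i ∧ i ≤ n ∧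
    (a : SRRing n k) = SRtheta n k i }

/-- The invariant ring `k[x_1,…,x_n]^W`: the fixed-point subalgebra of the
polynomial ring under the variable-permuting action of `W ≤ S_n`. -/
noncomputable def invariantRing (k : Type) [CommRing k] (n : ℕ)
    (W : Subgroup (Equiv.Perm (Fin n))) : Subalgebra k (MvPolynomial (Fin n) k) where
  carrier := { p | ∀ g ∈ W, MvPolynomial.rename (⇑g) p = p }
  add_mem' := by
    intro p q hp hq g hg
    rw [map_add, hp g hg, hq g hg]
  mul_mem' := by
    intro p q hp hq g hg
    rw [map_mul, hp g hg, hq g hg]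
  algebraMap_mem' := by
    intro r g hg
    simp [MvPolynomial.algebraMap_eq, MvPolynomial.rename_C]

/-- The subalgebra of the invariant ring generated over `k` by the elementary
symmetric polynomials `e_1, …, e_n`. -/
noncomputable def esymmSubalgebra (k : Type) [CommRing k] (n : ℕ)
    (W : Subgroup (Equiv.Perm (Fin n))) : Subalgebra k (invariantRing k n W) :=
  Algebra.adjoin k { a : invariantRing k n W | ∃ i : ℕ, 1 ≤ i ∧ i ≤ n ∧
    (a : MvPolynomial (Fin n) k) = MvPolynomial.esymm (Fin n) k i }



lemma aux_indep {A M ι : Type*} [CommRing A] [IsDomain A] [IsNoetherianRing A]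
    (I : Ideal A) (hI : I ≠ ⊤) [AddCommGroup M] [Module A M] [Module.Projective A M]
    (v : ι → M) (hspan : ⊤ ≤ Submodule.span A (Set.range v))
    (h : ∀ p : ι →₀ A, Finsupp.linearCombination A v p = 0 → ∀ i, p i ∈ I) :
    LinearIndependent A v := by
  have hsurj : Function.Surjective (Finsupp.linearCombination A v) := by
    rw [← LinearMap.range_eq_top, Finsupp.range_linearCombination]
    exact top_le_iff.mp hspan
  obtain ⟨σ, hσ⟩ := Module.projective_lifting_property (Finsupp.linearCombination A v)
    LinearMap.id hsurj
  have hσ' : ∀ m, Finsupp.linearCombination A v (σ m) = m := fun m =>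
    LinearMap.congr_fun hσ m
  have key : ∀ r : ℕ, ∀ p : ι →₀ A, Finsupp.linearCombination A v p = 0 →
      ∀ i, p i ∈ I ^ r := by
    intro r
    induction r with
    | zero => intro p _ i; simp
    | succ r ih =>
      intro p hp i
      let ρ : (ι →₀ A) →ₗ[A] (ι →₀ A) :=
        LinearMap.id - σ ∘ₗ (Finsupp.linearCombination A v)
      have h1 : ρ p = p := by simp [ρ, hp]
      have h2 : ∀ q, Finsupp.linearCombination A v (ρ q) = 0 := by
        intro q; simp [ρ, hσ']
      have h3 : ρ p = p.sum fun j a => a • ρ (Finsupp.single j 1) := by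
        conv_lhs => rw [← Finsupp.sum_single p]
        rw [map_finsuppSum]
        refine Finsupp.sum_congr fun j _ => ?_
        rw [← map_smul]; simp
      rw [← h1, h3, Finsupp.sum, Finsupp.finsetSum_apply]
      refine Ideal.sum_mem _ fun j _ => ?_
      rw [Finsupp.smul_apply, smul_eq_mul, pow_succ]
      exact Ideal.mul_mem_mul (ih p hp j) (h _ (h2 _) i)
  rw [linearIndependent_iff]
  intro p hp
  ext i
  have : p i ∈ (⨅ r : ℕ, I ^ r : Ideal A) := by
    rw [Ideal.mem_iInf]; exact fun r => key r p hp i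
  rw [Ideal.iInf_pow_eq_bot_of_isDomain I hI] at this
  simpa using this

open MvPolynomial in
theorem aux_abstract {k : Type*} [Field k] {n : ℕ} {M P : Type*}
    [AddCommGroup M] [AddCommGroup P] [Module k M] [Module k P]
    [Module (MvPolynomial (Fin n) k) M] [Module (MvPolynomial (Fin n) k) P]
    [IsScalarTower k (MvPolynomial (Fin n) k) M]
    [IsScalarTower k (MvPolynomial (Fin n) k) P]
    (π : ℕ → M →ₗ[k] M)
    (hπ : ∀ d m, π d (π d m) = π d m)
    (hπ' : ∀ d e m, d ≠ e → π d (π e m) = 0)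
    (hsum : ∀ m, ∃ N, m = ∑ d ∈ Finset.range N, π d m)
    (w : Fin n → ℕ) (hw : ∀ i, 0 < w i)
    (hgr : ∀ i d m, π d m = m →
      π (d + w i) ((X i : MvPolynomial (Fin n) k) • m) = (X i : MvPolynomial (Fin n) k) • m)
    (φ : M ≃ₗ[k] P)
    (hφ : ∀ i d m, π d m = m → ∀ e, d + w i ≤ e →
      π e (φ.symm ((X i : MvPolynomial (Fin n) k) • φ m)
        - (X i : MvPolynomial (Fin n) k) • m) = 0)
    (hfree : Module.Free (MvPolynomial (Fin n) k) M) :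
    Module.Free (MvPolynomial (Fin n) k) P := by
  classical
  let A := MvPolynomial (Fin n) k
  -- the subspace `A₊ M`
  let J : Submodule k M := Submodule.span k {y | ∃ (i : Fin n) (m : M), y = (X i : A) • m}
  have hJ : ∀ (p : A) (m : M), p • m - (constantCoeff p) • m ∈ J := by
    intro p m
    induction p using MvPolynomial.induction_on with
    | C a =>
      have : (C a : A) • m = a • m := by
        rw [← algebraMap_eq, algebraMap_smul]
      simp [this]
    | add p q hp hq =>
      have : (p + q) • m - (constantCoeff (p + q)) • m =
        (p • m - (constantCoeff p) • m) + (q • m - (constantCoeff q) • m) := by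
        rw [map_add, add_smul, add_smul]; abel
      rw [this]; exact J.add_mem hp hq
    | mul_X p i _ =>
      have : (p * X i) • m - (constantCoeff (p * X i)) • m = (X i : A) • (p • m) := by
        simp [mul_comm p, mul_smul]
      rw [this]; exact Submodule.subset_span ⟨i, _, rfl⟩
  obtain ⟨κ, a, -, hspan, hind⟩ := exists_linearIndependent' k
    (fun m : {m : M // ∃ d, π d m = m} => J.mkQ m.1)
  let b : κ → M := fun j => (a j).1
  choose D hD using fun j => (a j).2
  have hDb : ∀ j, π (D j) (b j) = b j := hD
  have hspan_b : ∀ m, ∃ y ∈ Submodule.span k (Set.range b), m - y ∈ J := by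
    intro m
    have h1 : J.mkQ m ∈ Submodule.span k
        (Set.range (fun m : {m : M // ∃ d, π d m = m} => J.mkQ m.1)) := by
      obtain ⟨N, hN⟩ := hsum m
      rw [hN, map_sum]
      exact Submodule.sum_mem _ fun d _ => Submodule.subset_span ⟨⟨π d m, d, hπ d m⟩, rfl⟩
    rw [← hspan] at h1
    have h2 : Submodule.span k (Set.range ((fun m : {m : M // ∃ d, π d m = m} => J.mkQ m.1) ∘ a))
        = (Submodule.span k (Set.range b)).map J.mkQ := by
      rw [Submodule.map_span, ← Set.range_comp]; rfl
    rw [h2] at h1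
    obtain ⟨y, hy, hy2⟩ := h1
    refine ⟨y, hy, ?_⟩
    rw [← Submodule.ker_mkQ J, LinearMap.mem_ker, map_sub, hy2, sub_self]
  -- graded Nakayama
  let N : Submodule A M := Submodule.span A (Set.range b)
  have hNk : ∀ y ∈ Submodule.span k (Set.range b), y ∈ N := by
    intro y hy
    exact Submodule.span_le_restrictScalars k A _ hy
  have hnak : ∀ d m, π d m = m → m ∈ N := by
    intro d
    induction d using Nat.strong_induction_on with
    | _ d ih =>
      intro m hm
      obtain ⟨y, hy, hmy⟩ := hspan_b m
      have h1 : π d y ∈ N := by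
        have : Submodule.span k (Set.range b) ≤ (N.restrictScalars k).comap (π d) := by
          rw [Submodule.span_le]
          rintro _ ⟨j, rfl⟩
          show π d (b j) ∈ N
          by_cases hdj : d = D j
          · rw [hdj, hDb]; exact Submodule.subset_span ⟨j, rfl⟩
          · rw [← hDb j, hπ' _ _ _ hdj]; exact N.zero_mem
        exact this hy
      have h2 : π d (m - y) ∈ N := by
        have : J ≤ (N.restrictScalars k).comap (π d) := by
          rw [Submodule.span_le]
          rintro _ ⟨i, m', rfl⟩
          show π d ((X i : A) • m') ∈ N
          obtain ⟨L, hL⟩ := hsum m'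
          rw [hL, Finset.smul_sum, map_sum]
          refine N.sum_mem fun e _ => ?_
          rw [← hgr i e _ (hπ e m')]
          by_cases hde : d = e + w i
          · rw [hde, hπ, hgr i e _ (hπ e m')]
            exact N.smul_mem _ (ih e (by have := hw i; omega) _ (hπ e m'))
          · rw [hπ' _ _ _ hde]; exact N.zero_mem
        exact this hmy
      have : m = π d y + π d (m - y) := by rw [← map_add]; simp [hm]
      rw [this]; exact N.add_mem h1 h2
  have hNtop : ⊤ ≤ N := by
    intro m _
    obtain ⟨L, hL⟩ := hsum m
    rw [hL]
    exact N.sum_mem fun d _ => hnak d _ (hπ d m)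
  have hli : LinearIndependent A b := by
    refine aux_indep (RingHom.ker (constantCoeff : A →+* k)) (RingHom.ker_ne_top _) b hNtop ?_
    intro p hp i
    rw [RingHom.mem_ker]
    let q : κ →₀ k := p.mapRange constantCoeff (map_zero _)
    have hq : Finsupp.linearCombination k b q ∈ J := by
      have h1 : Finsupp.linearCombination k b q = p.sum fun j c => (constantCoeff c) • b j := by
        rw [Finsupp.linearCombination_apply]
        exact Finsupp.sum_mapRange_index (by simp)
      have h2 : (0 : M) = p.sum fun j c => c • b j := by
        rw [← hp, Finsupp.linearCombination_apply]
      have h4 : Finsupp.linearCombination k b q =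
          - (p.sum fun j c => (c • b j - (constantCoeff c) • b j)) := by
        rw [h1, Finsupp.sum_sub, ← h2]; simp
      rw [h4]
      exact J.neg_mem (J.sum_mem fun j _ => hJ _ _)
    have := (linearIndependent_iff.mp hind) q (by
      have h5 : J.mkQ (Finsupp.linearCombination k b q) = 0 := by
        simpa using hq
      rw [← h5, Finsupp.linearCombination_apply, Finsupp.linearCombination_apply,
        map_finsuppSum]
      rfl)
    have h3 := DFunLike.congr_fun this i
    simpa [q] using h3
  let B : Module.Basis κ A M := Module.Basis.mk hli hNtop
  have hB : ∀ j, B j = b j := fun j => Module.Basis.mk_apply hli hNtop j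
  let V := (basisMonomials (Fin n) k).smulTower B
  have hV : ∀ c j, V (c, j) = (monomial c (1:k) : A) • b j := by
    intro c j
    simp [V, Module.Basis.smulTower_apply, hB]
  -- filtration
  let L : ℕ → Submodule k M := fun d =>
    { carrier := {m | ∀ e, d ≤ e → π e m = 0}
      add_mem' := by
        intro x y hx hy e he
        rw [map_add, hx e he, hy e he, add_zero]
      zero_mem' := by intro e _; simp
      smul_mem' := by
        intro c x hx e he
        rw [map_smul, hx e he, smul_zero] }
  have hLmono : ∀ d e, d ≤ e → L d ≤ L e := fun d e hde m hm f hf => hm f (hde.trans hf)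
  have hπL : ∀ d m, π d m ∈ L (d + 1) := by
    intro d m e he
    exact hπ' _ _ _ (by omega)
  have hLsum : ∀ d m, m ∈ L d → m = ∑ e ∈ Finset.range d, π e m := by
    intro d m hm
    obtain ⟨K, hK⟩ := hsum m
    conv_lhs => rw [hK]
    rcases le_total K d with h | h
    · refine Finset.sum_subset (Finset.range_mono h) ?_
      intro e he hne
      rw [hK, map_sum]
      refine Finset.sum_eq_zero fun f hf => hπ' _ _ _ ?_
      rintro rfl
      exact hne hf
    · symm
      refine Finset.sum_subset (Finset.range_mono h) ?_
      intro e he hne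
      exact hm e (by simpa using hne)
  have hXL : ∀ i d x, φ.symm x ∈ L d → φ.symm ((X i : A) • x) ∈ L (d + w i) := by
    intro i d x hx
    have h0 : x = φ (φ.symm x) := (φ.apply_symm_apply x).symm
    rw [h0, hLsum d _ hx, map_sum, Finset.smul_sum, map_sum]
    refine Submodule.sum_mem _ fun e he => ?_
    have he' := Finset.mem_range.mp he
    have h1 : φ.symm ((X i : A) • φ (π e (φ.symm x))) - (X i : A) • (π e (φ.symm x))
        ∈ L (e + w i) := fun f hf => hφ i e _ (hπ _ _) f hf
    have h2 : (X i : A) • (π e (φ.symm x)) ∈ L (e + w i + 1) := by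
      rw [← hgr i e _ (hπ _ _)]; exact hπL _ _
    have h3 := Submodule.add_mem _ (hLmono _ (d + w i) (by omega) h1)
      (hLmono _ (d + w i) (by omega) h2)
    simpa using h3
  have hmon : ∀ (c : Fin n →₀ ℕ) d m x, π d m = m → φ.symm x - m ∈ L d →
      π (d + Finsupp.weight w c) ((monomial c (1:k) : A) • m) = (monomial c (1:k) : A) • m ∧
      φ.symm ((monomial c (1:k) : A) • x) - (monomial c (1:k) : A) • m
        ∈ L (d + Finsupp.weight w c) := by
    intro c
    induction c using Finsupp.induction_linear with
    | zero =>
      intro d m x h1 h2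
      have : (monomial 0 (1:k) : A) = 1 := rfl
      simpa [this, h1] using h2
    | add c c' hc hc' =>
      intro d m x h1 h2
      obtain ⟨h3, h4⟩ := hc' d m x h1 h2
      obtain ⟨h5, h6⟩ := hc _ _ _ h3 h4
      have : (monomial (c + c') (1:k) : A) = monomial c 1 * monomial c' 1 := by
        simp [monomial_mul]
      rw [this, mul_smul, mul_smul, map_add, add_comm (Finsupp.weight w c), ← add_assoc]
      exact ⟨h5, h6⟩
    | single i r =>
      induction r with
      | zero =>
        intro d m x h1 h2
        have : (monomial 0 (1:k) : A) = 1 := rfl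
        simpa [this, h1] using h2
      | succ r ih =>
        intro d m x h1 h2
        obtain ⟨h3, h4⟩ := ih d m x h1 h2
        have : (monomial (Finsupp.single i (r+1)) (1:k) : A)
            = X i * monomial (Finsupp.single i r) 1 := by
          rw [X, monomial_mul, ← Finsupp.single_add, add_comm, one_mul]
        rw [this, mul_smul, mul_smul]
        have hwt : d + Finsupp.weight w (Finsupp.single i (r+1)) =
            (d + Finsupp.weight w (Finsupp.single i r)) + w i := by
          simp [Finsupp.weight_single]; ring
        rw [hwt]
        refine ⟨hgr i _ _ h3, ?_⟩
        set m' := (monomial (Finsupp.single i r) (1:k) : A) • m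
        set x' := (monomial (Finsupp.single i r) (1:k) : A) • x
        set d' := d + Finsupp.weight w (Finsupp.single i r)
        have h5 : φ.symm ((X i : A) • φ m') - (X i : A) • m' ∈ L (d' + w i) :=
          fun f hf => hφ i d' _ h3 f hf
        have h6 := hXL i d' (x' - φ m') (by simpa using h4)
        have h7 := Submodule.add_mem _ h5 h6
        rw [smul_sub, map_sub] at h7
        convert h7 using 1
        abel
  -- the comparison map
  let Ψ : (κ →₀ A) →ₗ[A] P := Finsupp.linearCombination A (fun j => φ (b j))
  let T : M →ₗ[k] M := φ.symm.toLinearMap ∘ₗ (Ψ.restrictScalars k) ∘ₗ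
    (B.repr.toLinearMap.restrictScalars k)
  have hT : ∀ m, T m = φ.symm (Ψ (B.repr m)) := fun m => rfl
  have hTV : ∀ c j, T (V (c, j)) = φ.symm ((monomial c (1:k) : A) • φ (b j)) := by
    intro c j
    rw [hT, hV, ← hB, map_smul, map_smul, Module.Basis.repr_self]
    simp [Ψ, hB]
  have hN1 : ∀ e m, T (π e m) - π e m ∈ L e := by
    intro e m
    have : (⊤ : Submodule k M) ≤ (L e).comap ((T - LinearMap.id) ∘ₗ π e) := by
      rw [← V.span_eq, Submodule.span_le]
      rintro _ ⟨⟨c, j⟩, rfl⟩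
      show T (π e (V (c, j))) - π e (V (c, j)) ∈ L e
      obtain ⟨h1, h2⟩ := hmon c (D j) (b j) (φ (b j)) (hDb j) (by simp)
      rw [← hV] at h1 h2
      rw [← hTV] at h2
      by_cases he : e = D j + Finsupp.weight w c
      · rw [he, h1]; exact h2
      · rw [← h1, hπ' _ _ _ he]; simp
    exact this (Submodule.mem_top (x := m))
  have hN2 : ∀ d m, m ∈ L (d + 1) → T m - m ∈ L d := by
    intro d m hm
    rw [hLsum _ m hm, map_sum, ← Finset.sum_sub_distrib]
    refine Submodule.sum_mem _ fun e he => hLmono e d ?_ (hN1 e m)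
    have := Finset.mem_range.mp he
    omega
  have hL0 : ∀ m, m ∈ L 0 → m = 0 := by
    intro m hm
    simpa using hLsum 0 m hm
  have hLex : ∀ m, ∃ d, m ∈ L d := by
    intro m
    obtain ⟨K, hK⟩ := hsum m
    refine ⟨K, ?_⟩
    rw [hK]
    refine Submodule.sum_mem _ fun e he => hLmono (e+1) K (Finset.mem_range.mp he) (hπL e m)
  have hTinj : ∀ d m, m ∈ L d → T m = 0 → m = 0 := by
    intro d
    induction d with
    | zero => intro m hm _; exact hL0 m hm
    | succ d ih =>
      intro m hm h0
      refine ih m ?_ h0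
      have := hN2 d m hm
      rw [h0, zero_sub] at this
      simpa using this
  have hTsurj : ∀ d m, m ∈ L d → m ∈ LinearMap.range T := by
    intro d
    induction d with
    | zero => intro m hm; rw [hL0 m hm]; exact Submodule.zero_mem _
    | succ d ih =>
      intro m hm
      have h1 := ih _ (hN2 d m hm)
      have h2 : m = T m - (T m - m) := by abel
      rw [h2]
      exact Submodule.sub_mem _ ⟨m, rfl⟩ h1
  have hΨ : Function.Bijective Ψ := by
    have hΨT : ∀ q, Ψ q = φ (T (B.repr.symm q)) := by
      intro q; rw [hT]; simp
    constructor
    · rw [← LinearMap.ker_eq_bot, LinearMap.ker_eq_bot']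
      intro q hq
      rw [hΨT] at hq
      have h1 : T (B.repr.symm q) = 0 := by simpa using hq
      obtain ⟨d, hd⟩ := hLex (B.repr.symm q)
      exact B.repr.symm.map_eq_zero_iff.mp (hTinj d _ hd h1)
    · intro x
      obtain ⟨d, hd⟩ := hLex (φ.symm x)
      obtain ⟨m, hm⟩ := hTsurj d _ hd
      refine ⟨B.repr m, ?_⟩
      rw [hΨT]
      simp [hm]
  exact Module.Free.of_equiv (LinearEquiv.ofBijective Ψ hΨ)

section SRAux
open MvPolynomial

noncomputable def srS {n : ℕ} (α : Fin n →₀ ℕ) : ℕ := ∑ i, ∑ j, max (α i) (α j)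

noncomputable def srInd {n : ℕ} (S : SRVertex n) : Fin n →₀ ℕ :=
  Finsupp.equivFunOnFinite.symm (fun i => if i ∈ S.1 then 1 else 0)

lemma srInd_apply {n : ℕ} (S : SRVertex n) (i : Fin n) :
    srInd S i = if i ∈ S.1 then 1 else 0 := rfl

noncomputable def srTot {n : ℕ} : (SRVertex n →₀ ℕ) →+ (Fin n →₀ ℕ) := Finsupp.weight srInd

noncomputable def srW {n : ℕ} : (SRVertex n →₀ ℕ) →+ ℕ :=
  Finsupp.weight (fun S => srS (srInd S))

def srChain {n : ℕ} (m : SRVertex n →₀ ℕ) : Prop :=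
  ∀ S ∈ m.support, ∀ T ∈ m.support, S.1 ⊆ T.1 ∨ T.1 ⊆ S.1

lemma srTot_apply {n : ℕ} (m : SRVertex n →₀ ℕ) (i : Fin n) :
    srTot m i = ∑ S ∈ m.support, m S * (if i ∈ S.1 then 1 else 0) := by
  rw [srTot, Finsupp.weight_apply, Finsupp.sum, Finsupp.finsetSum_apply]
  rfl

lemma srTot_single {n : ℕ} (S : SRVertex n) : srTot (Finsupp.single S 1) = srInd S := by
  simp [srTot, Finsupp.weight_single]

lemma srTot_pos {n : ℕ} {m : SRVertex n →₀ ℕ} {i : Fin n} :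
    srTot m i ≠ 0 ↔ ∃ S ∈ m.support, i ∈ S.1 := by
  rw [srTot_apply, Ne, Finset.sum_eq_zero_iff]
  push Not
  refine exists_congr fun S => and_congr_right fun hS => ?_
  have := Finsupp.mem_support_iff.mp hS
  by_cases h : i ∈ S.1 <;> simp [h, this]

lemma srW_apply {n : ℕ} (m : SRVertex n →₀ ℕ) :
    srW m = ∑ i, ∑ j, ∑ S ∈ m.support, m S *
      max (if i ∈ S.1 then 1 else 0) (if j ∈ S.1 then 1 else 0) := by
  rw [srW, Finsupp.weight_apply, Finsupp.sum]
  simp only [srS, smul_eq_mul, Finset.mul_sum, srInd_apply]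
  rw [Finset.sum_comm]
  refine Finset.sum_congr rfl fun i _ => ?_
  rw [Finset.sum_comm]

lemma srPair_le {n : ℕ} (m : SRVertex n →₀ ℕ) (i j : Fin n) :
    max (srTot m i) (srTot m j) ≤ ∑ S ∈ m.support, m S *
      max (if i ∈ S.1 then 1 else 0) (if j ∈ S.1 then 1 else 0) := by
  rw [srTot_apply, srTot_apply]
  refine max_le ?_ ?_
  · exact Finset.sum_le_sum fun S _ => Nat.mul_le_mul_left _ (le_max_left _ _)
  · exact Finset.sum_le_sum fun S _ => Nat.mul_le_mul_left _ (le_max_right _ _)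

lemma srPair_eq {n : ℕ} (m : SRVertex n →₀ ℕ) (hm : srChain m) (i j : Fin n) :
    max (srTot m i) (srTot m j) = ∑ S ∈ m.support, m S *
      max (if i ∈ S.1 then 1 else 0) (if j ∈ S.1 then 1 else 0) := by
  refine le_antisymm (srPair_le m i j) ?_
  rw [srTot_apply, srTot_apply]
  by_cases h : ∀ S ∈ m.support, i ∈ S.1 → j ∈ S.1
  · refine le_max_of_le_right (Finset.sum_le_sum fun S hS => Nat.mul_le_mul_left _ ?_)
    have := h S hS
    by_cases h1 : i ∈ S.1 <;> by_cases h2 : j ∈ S.1 <;> simp_all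
  · push Not at h
    obtain ⟨S₀, hS₀, hi, hj⟩ := h
    refine le_max_of_le_left (Finset.sum_le_sum fun S hS => Nat.mul_le_mul_left _ ?_)
    have : j ∈ S.1 → i ∈ S.1 := by
      intro hjS
      rcases hm S₀ hS₀ S hS with h | h
      · exact h hi
      · exact absurd (h hjS) hj
    by_cases h1 : i ∈ S.1 <;> by_cases h2 : j ∈ S.1 <;> simp_all

lemma srS_le {n : ℕ} (m : SRVertex n →₀ ℕ) : srS (srTot m) ≤ srW m := by
  rw [srW_apply, srS]
  exact Finset.sum_le_sum fun i _ => Finset.sum_le_sum fun j _ => srPair_le m i j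

lemma srS_eq {n : ℕ} (m : SRVertex n →₀ ℕ) (hm : srChain m) : srS (srTot m) = srW m := by
  rw [srW_apply, srS]
  exact Finset.sum_congr rfl fun i _ => Finset.sum_congr rfl fun j _ => srPair_eq m hm i j

lemma srS_lt {n : ℕ} (m : SRVertex n →₀ ℕ) (hm : ¬ srChain m) : srS (srTot m) < srW m := by
  unfold srChain at hm
  push Not at hm
  obtain ⟨S, hS, T, hT, hST, hTS⟩ := hm
  obtain ⟨i, hiS, hiT⟩ := Finset.not_subset.mp hST
  obtain ⟨j, hjT, hjS⟩ := Finset.not_subset.mp hTS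
  rw [srW_apply, srS]
  refine Finset.sum_lt_sum (fun i _ => Finset.sum_le_sum fun j _ => srPair_le m i j)
    ⟨i, Finset.mem_univ _, ?_⟩
  refine Finset.sum_lt_sum (fun j _ => srPair_le m i j) ⟨j, Finset.mem_univ _, ?_⟩
  rw [srTot_apply, srTot_apply]
  have h1 := Nat.pos_of_ne_zero (Finsupp.mem_support_iff.mp hS)
  have h2 := Nat.pos_of_ne_zero (Finsupp.mem_support_iff.mp hT)
  refine max_lt ?_ ?_
  · refine Finset.sum_lt_sum (fun S _ => Nat.mul_le_mul_left _ (le_max_left _ _))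
      ⟨T, hT, ?_⟩
    simp [hiT, hjT, h2]
  · refine Finset.sum_lt_sum (fun S _ => Nat.mul_le_mul_left _ (le_max_right _ _))
      ⟨S, hS, ?_⟩
    simp [hiS, hjS, h1]

lemma srChain_exists {n : ℕ} (α : Fin n →₀ ℕ) : ∃ m, srChain m ∧ srTot m = α := by
  induction hN : α.degree using Nat.strong_induction_on generalizing α with
  | _ N ih =>
    by_cases h0 : α = 0
    · exact ⟨0, by intro S hS; simp at hS, by simp [h0]⟩
    have hne : α.support.Nonempty := Finsupp.support_nonempty_iff.mpr h0
    let S : SRVertex n := ⟨α.support, hne⟩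
    have hle : srInd S ≤ α := by
      intro i
      rw [srInd_apply]
      split_ifs with h
      · exact Nat.one_le_iff_ne_zero.mpr (Finsupp.mem_support_iff.mp h)
      · exact Nat.zero_le _
    have hα : (α - srInd S) + srInd S = α := tsub_add_cancel_of_le hle
    have hdeg : (α - srInd S).degree < N := by
      rw [← hN]
      conv_rhs => rw [← hα]
      rw [map_add]
      have : (srInd S).degree ≠ 0 := by
        rw [Ne, Finsupp.degree_eq_zero_iff]
        intro h
        obtain ⟨i, hi⟩ := hne
        have h2 := DFunLike.congr_fun h i
        rw [srInd_apply, if_pos (show i ∈ S.1 from hi)] at h2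
        simp at h2
      omega
    obtain ⟨m', hm', ht⟩ := ih _ hdeg (α - srInd S) rfl
    have hsub : ∀ T ∈ m'.support, T.1 ⊆ S.1 := by
      intro T hT i hi
      have h1 : srTot m' i ≠ 0 := srTot_pos.mpr ⟨T, hT, hi⟩
      rw [ht] at h1
      show i ∈ α.support
      rw [Finsupp.mem_support_iff]
      intro h2
      apply h1
      simp [h2]
    refine ⟨m' + Finsupp.single S 1, ?_, by rw [map_add, ht, srTot_single, hα]⟩
    have hmem : ∀ T ∈ (m' + Finsupp.single S 1).support, T ∈ m'.support ∨ T = S := by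
      intro T hT
      by_cases hTS : T = S
      · exact Or.inr hTS
      · left
        rw [Finsupp.mem_support_iff] at hT ⊢
        simpa [Finsupp.single_apply, Ne.symm hTS] using hT
    intro T hT U hU
    rcases hmem T hT with h | h <;> rcases hmem U hU with h' | h'
    · exact hm' T h U h'
    · rw [h']; exact Or.inl (hsub T h)
    · rw [h]; exact Or.inr (hsub U h')
    · rw [h, h']; exact Or.inl subset_rfl

lemma srChain_mono {n : ℕ} {m m' : SRVertex n →₀ ℕ} (h : m ≤ m') (hm : srChain m') :
    srChain m := by
  intro S hS T hT
  exact hm S (Finsupp.support_mono h hS) T (Finsupp.support_mono h hT)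

lemma srChain_top {n : ℕ} {m : SRVertex n →₀ ℕ} (hm : srChain m) (h0 : m ≠ 0) :
    ∃ S ∈ m.support, S.1 = (srTot m).support := by
  obtain ⟨S, hS, hmax⟩ := Finset.exists_max_image m.support (fun S => S.1.card)
    (Finsupp.support_nonempty_iff.mpr h0)
  refine ⟨S, hS, ?_⟩
  ext i
  rw [Finsupp.mem_support_iff, srTot_pos]
  refine ⟨fun h => ⟨S, hS, h⟩, ?_⟩
  rintro ⟨T, hT, hi⟩
  rcases hm S hS T hT with h | h
  · rw [Finset.eq_of_subset_of_card_le h (hmax T hT)]; exact hi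
  · exact h hi

lemma srTot_eq_zero {n : ℕ} {m : SRVertex n →₀ ℕ} (h : srTot m = 0) : m = 0 := by
  by_contra h0
  obtain ⟨S, hS⟩ := Finsupp.support_nonempty_iff.mpr h0
  obtain ⟨i, hi⟩ := S.2
  exact (srTot_pos.mpr ⟨S, hS, hi⟩) (by rw [h]; rfl)

lemma srChain_unique {n : ℕ} (m m' : SRVertex n →₀ ℕ) (hm : srChain m) (hm' : srChain m')
    (h : srTot m = srTot m') : m = m' := by
  induction hN : m.degree using Nat.strong_induction_on generalizing m m' with
  | _ N ih =>
    by_cases h0 : m = 0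
    · subst h0
      exact (srTot_eq_zero (by rw [← h, map_zero])).symm
    have h0' : m' ≠ 0 := by
      rintro rfl
      exact h0 (srTot_eq_zero (by rw [h, map_zero]))
    obtain ⟨S, hS, hS2⟩ := srChain_top hm h0
    obtain ⟨S', hS', hS2'⟩ := srChain_top hm' h0'
    have : S' = S := Subtype.ext (by rw [hS2, hS2', h])
    subst this
    have hle : Finsupp.single S' 1 ≤ m := by
      rw [Finsupp.single_le_iff]
      exact Nat.one_le_iff_ne_zero.mpr (Finsupp.mem_support_iff.mp hS)
    have hle' : Finsupp.single S' 1 ≤ m' := by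
      rw [Finsupp.single_le_iff]
      exact Nat.one_le_iff_ne_zero.mpr (Finsupp.mem_support_iff.mp hS')
    have e1 : (m - Finsupp.single S' 1) + Finsupp.single S' 1 = m := tsub_add_cancel_of_le hle
    have e2 : (m' - Finsupp.single S' 1) + Finsupp.single S' 1 = m' :=
      tsub_add_cancel_of_le hle'
    rw [← e1, ← e2]
    congr 1
    refine ih (m - Finsupp.single S' 1).degree ?_ _ _ (srChain_mono tsub_le_self hm)
      (srChain_mono tsub_le_self hm') ?_ rfl
    · rw [← hN]
      conv_rhs => rw [← e1]
      rw [map_add]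
      simp
    · have h3 : srTot (m - Finsupp.single S' 1) + srInd S'
          = srTot (m' - Finsupp.single S' 1) + srInd S' := by
        rw [← srTot_single, ← map_add, ← map_add, e1, e2, h]
      exact add_right_cancel h3

lemma srS_ind {n : ℕ} (S : SRVertex n) :
    srS (srInd S) = S.1.card * n + (n - S.1.card) * S.1.card := by
  classical
  unfold srS
  have h1 : ∀ i, ∑ j, max (srInd S i) (srInd S j) = if i ∈ S.1 then n else S.1.card := by
    intro i
    simp only [srInd_apply]
    split_ifs with h
    · have : ∀ j, max 1 (if j ∈ S.1 then 1 else 0) = 1 := by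
        intro j; split_ifs <;> simp
      simp [this]
    · simp
  simp only [h1]
  rw [Finset.sum_ite]
  simp [Finset.filter_not, Finset.card_sdiff]

lemma srS_map {n : ℕ} (g : Equiv.Perm (Fin n)) (α : Fin n →₀ ℕ) :
    srS (α.mapDomain g) = srS α := by
  unfold srS
  rw [← Equiv.sum_comp g]
  refine Finset.sum_congr rfl fun i _ => ?_
  rw [← Equiv.sum_comp g]
  refine Finset.sum_congr rfl fun j _ => ?_
  rw [Finsupp.mapDomain_apply g.injective, Finsupp.mapDomain_apply g.injective]

lemma srPerm_injective {n : ℕ} (g : Equiv.Perm (Fin n)) :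
    Function.Injective (SRpermVertex n g) := by
  intro S T h
  have := congrArg Subtype.val h
  exact Subtype.ext (Finset.image_injective g.injective this)

lemma srTot_map {n : ℕ} (g : Equiv.Perm (Fin n)) (m : SRVertex n →₀ ℕ) :
    srTot (m.mapDomain (SRpermVertex n g)) = (srTot m).mapDomain g := by
  induction m using Finsupp.induction_linear with
  | zero => simp
  | add a b ha hb => rw [Finsupp.mapDomain_add, map_add, map_add, Finsupp.mapDomain_add, ha, hb]
  | single S r =>
    rw [Finsupp.mapDomain_single, srTot, Finsupp.weight_single, Finsupp.weight_single,
      Finsupp.mapDomain_smul]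
    congr 1
    ext i
    obtain ⟨j, rfl⟩ := g.surjective i
    rw [Finsupp.mapDomain_apply g.injective, srInd_apply, srInd_apply]
    simp [SRpermVertex]

lemma srChain_map {n : ℕ} (g : Equiv.Perm (Fin n)) (m : SRVertex n →₀ ℕ) :
    srChain (m.mapDomain (SRpermVertex n g)) ↔ srChain m := by
  classical
  unfold srChain
  rw [Finsupp.mapDomain_support_of_injective (srPerm_injective g)]
  simp only [Finset.forall_mem_image]
  refine forall₂_congr fun S _ => forall₂_congr fun T _ => ?_
  simp only [SRpermVertex]
  rw [Finset.image_subset_image_iff g.injective, Finset.image_subset_image_iff g.injective]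

open Classical in
lemma sr_exists (n : ℕ) (k : Type) [Field k] :
    ∃ φ : SRRing n k ≃ₗ[k] MvPolynomial (Fin n) k, ∀ m c,
      φ (Ideal.Quotient.mk (SRIdeal n k) (monomial m c)) =
        if srChain m then monomial (srTot m) c else 0 := by
  let Φ : MvPolynomial (SRVertex n) k →ₗ[k] MvPolynomial (Fin n) k :=
    (basisMonomials (SRVertex n) k).constr k
      (fun m => if srChain m then monomial (srTot m) 1 else 0)
  have hΦ : ∀ m c, Φ (monomial m c) = if srChain m then monomial (srTot m) c else 0 := by
    intro m c
    have h1 : (monomial m c : MvPolynomial (SRVertex n) k) =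
        c • basisMonomials (SRVertex n) k m := by
      simp [coe_basisMonomials, smul_monomial]
    rw [h1, map_smul, Module.Basis.constr_basis]
    split_ifs <;> simp [smul_monomial]
  have hker : ∀ x ∈ SRIdeal n k, Φ x = 0 := by
    intro x hx
    have : ∀ a, Φ (a * x) = 0 := by
      rw [SRIdeal] at hx
      induction hx using Submodule.span_induction with
      | mem x hx =>
        obtain ⟨S, T, h1, h2, rfl⟩ := hx
        intro a
        induction a using MvPolynomial.induction_on' with
        | monomial u c =>
          rw [X, X, monomial_mul, monomial_mul, hΦ, if_neg]
          intro hc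
          rcases hc S (by simp) T (by simp) with h | h
          · exact h1 h
          · exact h2 h
        | add p q hp hq => rw [add_mul, map_add, hp, hq, add_zero]
      | zero => simp
      | add x y _ _ hx hy => intro a; rw [mul_add, map_add, hx, hy, add_zero]
      | smul b x _ hx => intro a; rw [smul_eq_mul, ← mul_assoc]; exact hx _
    simpa using this 1
  let φ₀ : SRRing n k →ₗ[k] MvPolynomial (Fin n) k :=
    { toFun := Quotient.lift (fun p => Φ p) (by
        intro a b hab
        have := hker (a - b) ((Submodule.quotientRel_def _).mp hab)
        rw [map_sub] at this
        exact sub_eq_zero.mp this)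
      map_add' := by
        intro x y
        obtain ⟨x, rfl⟩ := Ideal.Quotient.mk_surjective x
        obtain ⟨y, rfl⟩ := Ideal.Quotient.mk_surjective y
        exact map_add Φ x y
      map_smul' := by
        intro c x
        obtain ⟨x, rfl⟩ := Ideal.Quotient.mk_surjective x
        exact map_smul Φ c x }
  have hφ₀ : ∀ p, φ₀ (Ideal.Quotient.mk (SRIdeal n k) p) = Φ p := fun p => rfl
  choose μ hμ1 hμ2 using fun α => srChain_exists (n := n) α
  let mkL : MvPolynomial (SRVertex n) k →ₗ[k] SRRing n k :=
    (Ideal.Quotient.mkₐ k (SRIdeal n k)).toLinearMap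
  have hmkL : ∀ p, mkL p = Ideal.Quotient.mk (SRIdeal n k) p := fun p => rfl
  let ψ : MvPolynomial (Fin n) k →ₗ[k] SRRing n k :=
    (basisMonomials (Fin n) k).constr k (fun α => mkL (monomial (μ α) 1))
  have hψ : ∀ α c, ψ (monomial α c) = mkL (monomial (μ α) c) := by
    intro α c
    have h1 : (monomial α c : MvPolynomial (Fin n) k) = c • basisMonomials (Fin n) k α := by
      simp [coe_basisMonomials, smul_monomial]
    rw [h1, map_smul, Module.Basis.constr_basis, ← map_smul]
    simp [smul_monomial]
  have H1 : φ₀ ∘ₗ ψ = LinearMap.id := by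
    refine LinearMap.ext fun f => ?_
    rw [LinearMap.comp_apply, LinearMap.id_apply]
    induction f using MvPolynomial.induction_on' with
    | monomial α c => rw [hψ, hmkL, hφ₀, hΦ, if_pos (hμ1 α), hμ2]
    | add p q hp hq => simp only [map_add, hp, hq]
  have H2 : ψ ∘ₗ φ₀ = LinearMap.id := by
    have : ∀ p, ψ (φ₀ (mkL p)) = mkL p := by
      intro p
      induction p using MvPolynomial.induction_on' with
      | monomial m c =>
        rw [hmkL, hφ₀, hΦ]
        split_ifs with h
        · rw [hψ, srChain_unique _ _ (hμ1 _) h (hμ2 _), hmkL]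
        · rw [map_zero]
          symm
          rw [Ideal.Quotient.eq_zero_iff_mem]
          unfold srChain at h
          push Not at h
          obtain ⟨S, hS, T, hT, hST, hTS⟩ := h
          have hne : S ≠ T := by rintro rfl; exact hST subset_rfl
          have hle : Finsupp.single S 1 + Finsupp.single T 1 ≤ m := by
            intro U
            rw [Finsupp.mem_support_iff] at hS hT
            rw [Finsupp.add_apply, Finsupp.single_apply, Finsupp.single_apply]
            split_ifs with h1 h2 h2
            · exact absurd (h1.trans h2.symm) hne
            · subst h1; omega
            · subst h2; omega
            · omega
          have : (monomial m c : MvPolynomial (SRVertex n) k) =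
              monomial (m - (Finsupp.single S 1 + Finsupp.single T 1)) c * (X S * X T) := by
            rw [X, X, monomial_mul, monomial_mul, tsub_add_cancel_of_le hle]; simp
          rw [this]
          exact Ideal.mul_mem_left _ _ (Ideal.subset_span ⟨S, T, hST, hTS, rfl⟩)
      | add p q hp hq => simp only [map_add, hp, hq]
    refine LinearMap.ext fun r => ?_
    obtain ⟨p, rfl⟩ := Ideal.Quotient.mk_surjective r
    exact this p
  obtain ⟨e, H3⟩ : ∃ e : SRRing n k ≃ₗ[k] MvPolynomial (Fin n) k, ∀ x, e x = φ₀ x :=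
    ⟨LinearEquiv.ofBijective φ₀ ⟨fun x y hxy => by
        have h1 := LinearMap.congr_fun H2 x
        have h2 := LinearMap.congr_fun H2 y
        rw [LinearMap.comp_apply, LinearMap.id_apply] at h1 h2
        rw [← h1, ← h2, hxy], fun y => ⟨ψ y, LinearMap.congr_fun H1 y⟩⟩,
      fun x => LinearEquiv.ofBijective_apply φ₀ x⟩
  refine ⟨e, fun m c => ?_⟩
  rw [H3, hφ₀, hΦ]

open Classical in
noncomputable def srPr {n : ℕ} {k : Type} [Field k] (d : ℕ) :
    MvPolynomial (Fin n) k →ₗ[k] MvPolynomial (Fin n) k :=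
  (basisMonomials (Fin n) k).constr k (fun α => if srS α = d then monomial α 1 else 0)

lemma srPr_monomial {n : ℕ} {k : Type} [Field k] (d : ℕ) (α : Fin n →₀ ℕ) (c : k) :
    srPr d (monomial α c) = if srS α = d then monomial α c else 0 := by
  classical
  have h1 : (monomial α c : MvPolynomial (Fin n) k) = c • basisMonomials (Fin n) k α := by
    simp [coe_basisMonomials, smul_monomial]
  rw [h1, map_smul, srPr, Module.Basis.constr_basis]
  split_ifs <;> simp [smul_monomial]

lemma srPr_idem {n : ℕ} {k : Type} [Field k] (d : ℕ) (f : MvPolynomial (Fin n) k) :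
    srPr d (srPr d f) = srPr d f := by
  induction f using MvPolynomial.induction_on' with
  | monomial α c =>
    rw [srPr_monomial]
    split_ifs with h
    · rw [srPr_monomial, if_pos h]
    · simp
  | add p q hp hq => simp only [map_add, hp, hq]

lemma srPr_orth {n : ℕ} {k : Type} [Field k] (d e : ℕ) (f : MvPolynomial (Fin n) k)
    (hde : d ≠ e) : srPr d (srPr e f) = 0 := by
  induction f using MvPolynomial.induction_on' with
  | monomial α c =>
    rw [srPr_monomial]
    split_ifs with h
    · rw [srPr_monomial, if_neg (by omega)]
    · simp
  | add p q hp hq => simp only [map_add, hp, hq, add_zero]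

lemma srPr_sum {n : ℕ} {k : Type} [Field k] (f : MvPolynomial (Fin n) k) :
    ∃ N, ∀ N', N ≤ N' → f = ∑ d ∈ Finset.range N', srPr d f := by
  induction f using MvPolynomial.induction_on' with
  | monomial α c =>
    refine ⟨srS α + 1, fun N hN => ?_⟩
    simp only [srPr_monomial]
    rw [Finset.sum_ite_eq, if_pos (Finset.mem_range.mpr hN)]
  | add p q hp hq =>
    obtain ⟨N1, h1⟩ := hp
    obtain ⟨N2, h2⟩ := hq
    refine ⟨max N1 N2, fun N hN => ?_⟩
    simp only [map_add]
    rw [Finset.sum_add_distrib, ← h1 N (le_trans (le_max_left _ _) hN),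
      ← h2 N (le_trans (le_max_right _ _) hN)]

lemma srPr_rename {n : ℕ} {k : Type} [Field k] (d : ℕ) (g : Equiv.Perm (Fin n))
    (f : MvPolynomial (Fin n) k) : srPr d (rename g f) = rename g (srPr d f) := by
  induction f using MvPolynomial.induction_on' with
  | monomial α c =>
    rw [rename_monomial, srPr_monomial, srPr_monomial, srS_map]
    split_ifs
    · rw [rename_monomial]
    · simp
  | add p q hp hq => simp only [map_add, hp, hq]

open Classical in
lemma sr_mul {n : ℕ} {k : Type} [Field k] (φ : SRRing n k ≃ₗ[k] MvPolynomial (Fin n) k)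
    (hφ : ∀ m c, φ (Ideal.Quotient.mk (SRIdeal n k) (monomial m c)) =
        if srChain m then monomial (srTot m) c else 0)
    (a b : ℕ) (f g : MvPolynomial (Fin n) k) :
    srPr (a + b) (φ (φ.symm (srPr a f) * φ.symm (srPr b g))) =
      φ (φ.symm (srPr a f) * φ.symm (srPr b g)) ∧
    ∀ e, a + b ≤ e →
      srPr e (srPr a f * srPr b g - φ (φ.symm (srPr a f) * φ.symm (srPr b g))) = 0 := by
  induction f using MvPolynomial.induction_on' with
  | monomial α c =>
    induction g using MvPolynomial.induction_on' with
    | monomial β c' =>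
      rw [srPr_monomial, srPr_monomial]
      split_ifs with h1 h2 h2
      · obtain ⟨m, hm, rfl⟩ := srChain_exists α
        obtain ⟨m', hm', rfl⟩ := srChain_exists β
        have e1 : φ.symm (monomial (srTot m) c) =
            Ideal.Quotient.mk (SRIdeal n k) (monomial m c) := by
          rw [LinearEquiv.symm_apply_eq, hφ, if_pos hm]
        have e2 : φ.symm (monomial (srTot m') c') =
            Ideal.Quotient.mk (SRIdeal n k) (monomial m' c') := by
          rw [LinearEquiv.symm_apply_eq, hφ, if_pos hm']
        rw [e1, e2, ← map_mul, monomial_mul, hφ, monomial_mul, ← map_add]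
        rw [srS_eq m hm] at h1
        rw [srS_eq m' hm'] at h2
        split_ifs with h3
        · have h4 := srS_eq _ h3
          rw [map_add srW, h1, h2] at h4
          rw [srPr_monomial, if_pos h4]
          simp
        · have h4 := srS_lt _ h3
          rw [map_add srW, h1, h2] at h4
          refine ⟨by simp, fun e he => ?_⟩
          rw [sub_zero, srPr_monomial, if_neg (by omega)]
      all_goals simp
    | add p q hp hq =>
      refine ⟨?_, fun e he => ?_⟩
      · simp only [map_add, mul_add, hp.1, hq.1]
      · have h1 := hp.2 e he
        have h2 := hq.2 e he
        simp only [map_add, mul_add]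
        rw [add_sub_add_comm, map_add, h1, h2, add_zero]
  | add p q hp hq =>
    refine ⟨?_, fun e he => ?_⟩
    · simp only [map_add, add_mul, hp.1, hq.1]
    · have h1 := hp.2 e he
      have h2 := hq.2 e he
      simp only [map_add, add_mul]
      rw [add_sub_add_comm, map_add, h1, h2, add_zero]

open Classical in
lemma sr_equivariant {n : ℕ} {k : Type} [Field k]
    (φ : SRRing n k ≃ₗ[k] MvPolynomial (Fin n) k)
    (hφ : ∀ m c, φ (Ideal.Quotient.mk (SRIdeal n k) (monomial m c)) =
        if srChain m then monomial (srTot m) c else 0)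
    (g : Equiv.Perm (Fin n)) (r : SRRing n k) :
    φ (SRmap n k g r) = rename g (φ r) := by
  obtain ⟨p, rfl⟩ := Ideal.Quotient.mk_surjective r
  induction p using MvPolynomial.induction_on' with
  | monomial m c =>
    have : SRmap n k g (Ideal.Quotient.mk (SRIdeal n k) (monomial m c)) =
        Ideal.Quotient.mk (SRIdeal n k) (monomial (m.mapDomain (SRpermVertex n g)) c) := by
      rw [SRmap, Ideal.quotientMap_mk]
      congr 1
      exact rename_monomial _ _ _
    rw [this, hφ, hφ]
    simp only [srChain_map, srTot_map]
    split_ifs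
    · rw [rename_monomial]
    · simp
  | add p q hp hq => simp only [map_add, hp, hq]

open Classical in
lemma sr_theta {n : ℕ} {k : Type} [Field k]
    (φ : SRRing n k ≃ₗ[k] MvPolynomial (Fin n) k)
    (hφ : ∀ m c, φ (Ideal.Quotient.mk (SRIdeal n k) (monomial m c)) =
        if srChain m then monomial (srTot m) c else 0)
    (i : ℕ) (hi : 1 ≤ i) :
    φ (SRtheta n k i) = esymm (Fin n) k i ∧
    srPr (i * n + (n - i) * i) (esymm (Fin n) k i) = esymm (Fin n) k i := by
  have h1 : φ (SRtheta n k i) =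
      ∑ S ∈ Finset.univ.filter (fun S : SRVertex n => S.1.card = i), monomial (srInd S) 1 := by
    rw [SRtheta, map_sum, map_sum]
    refine Finset.sum_congr rfl fun S _ => ?_
    rw [X, hφ, if_pos, srTot_single]
    intro U hU T hT
    have hU' := Finsupp.support_single_subset hU
    have hT' := Finsupp.support_single_subset hT
    rw [Finset.mem_singleton] at hU' hT'
    rw [hU', hT']
    exact Or.inl subset_rfl
  have h2 : φ (SRtheta n k i) = esymm (Fin n) k i := by
    rw [h1, esymm_eq_sum_monomial]
    refine Finset.sum_bij (fun S _ => S.1) ?_ ?_ ?_ ?_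
    · intro S hS
      simpa [Finset.mem_powersetCard] using hS
    · intro S _ T _ h
      exact Subtype.ext h
    · intro t ht
      have ht' : t.card = i := (Finset.mem_powersetCard.mp ht).2
      exact ⟨⟨t, Finset.card_pos.mp (by omega)⟩, by simpa using ht', rfl⟩
    · intro S _
      have : srInd S = ∑ i ∈ S.1, Finsupp.single i 1 := by
        ext j
        rw [srInd_apply, Finsupp.finsetSum_apply]
        simp [Finsupp.single_apply]
      rw [this]
  refine ⟨h2, ?_⟩
  rw [← h2, h1, map_sum]
  refine Finset.sum_congr rfl fun S hS => ?_
  have hS' : S.1.card = i := by simpa using hS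
  rw [srPr_monomial, if_pos]
  rw [srS_ind, hS']

lemma sr_theta_indep (n : ℕ) (k : Type) [Field k] :
    Function.Injective (aeval (R := k) (fun i : Fin n => SRtheta n k (i + 1))) := by
  classical
  let v : SRVertex n → MvPolynomial (Fin n) k := fun S =>
    ∑ i : Fin n, if S.1 = Finset.Iic i then X i else 0
  have hI : ∀ x ∈ SRIdeal n k, aeval v x = 0 := by
    intro x hx
    have : SRIdeal n k ≤ RingHom.ker (aeval v : MvPolynomial (SRVertex n) k →ₐ[k] _) := by
      rw [SRIdeal, Ideal.span_le]
      rintro _ ⟨S, T, h1, h2, rfl⟩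
      rw [SetLike.mem_coe, RingHom.mem_ker, map_mul, aeval_X, aeval_X, Finset.sum_mul_sum]
      refine Finset.sum_eq_zero fun i _ => Finset.sum_eq_zero fun j _ => ?_
      split_ifs with h3 h4 <;> try simp
      rcases le_total i j with h | h
      · exact h1 (by rw [h3, h4]; exact Finset.Iic_subset_Iic.mpr h)
      · exact h2 (by rw [h3, h4]; exact Finset.Iic_subset_Iic.mpr h)
    exact this hx
  let ρ : SRRing n k →ₐ[k] MvPolynomial (Fin n) k := Ideal.Quotient.liftₐ (SRIdeal n k) (aeval v) hI
  have hρ : ∀ i : Fin n, ρ (SRtheta n k (i + 1)) = X i := by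
    intro i
    have : ρ (SRtheta n k (i + 1)) = aeval v (∑ S ∈ Finset.univ.filter
      (fun S : SRVertex n => S.1.card = i + 1), X S) := rfl
    rw [this, map_sum]
    simp only [aeval_X, v]
    rw [Finset.sum_comm, Finset.sum_eq_single i]
    · rw [Finset.sum_eq_single ⟨Finset.Iic i, ⟨i, by simp⟩⟩]
      · simp
      · intro S _ hS
        rw [if_neg]
        intro h; exact hS (Subtype.ext h)
      · intro h; simp at h
    · intro j _ hj
      refine Finset.sum_eq_zero fun S hS => ?_
      rw [if_neg]
      intro h
      have hS' : S.1.card = i + 1 := by simpa using hS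
      rw [h, Fin.card_Iic] at hS'
      exact hj (Fin.ext (by omega))
    · intro h; simp at h
  have hcomp : ρ.comp (aeval (R := k) (fun i : Fin n => SRtheta n k (i + 1))) =
      AlgHom.id k _ := by
    ext1 i
    simp [hρ]
  intro p q h
  have := congrArg ρ h
  rw [← AlgHom.comp_apply, ← AlgHom.comp_apply, hcomp] at this
  simpa using this

lemma sr_transfer {k A B : Type*} [Field k] [CommRing A] [CommRing B] [Algebra k A] [Algebra k B]
    (f : A →ₐ[k] B) (hf : Function.Injective f) (S : Subalgebra k B) (hS : S = f.range) :
    (Module.Free S B ↔ @Module.Free A B _ _ (Module.compHom B f.toRingHom)) := by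
  subst hS
  letI : Module A B := Module.compHom B f.toRingHom
  let e : A ≃+* f.range := (AlgEquiv.ofInjective f hf).toRingEquiv
  letI : RingHomInvPair (e : A →+* f.range) (e.symm : f.range →+* A) :=
    RingHomInvPair.of_ringEquiv e
  letI : RingHomInvPair (e.symm : f.range →+* A) (e : A →+* f.range) :=
    RingHomInvPair.of_ringEquiv e.symm
  let e₂ : B ≃ₛₗ[(e : A →+* f.range)] B :=
    { AddEquiv.refl B with
      map_smul' := fun a b => rfl }
  exact (Module.Free.iff_of_equiv e₂).symm

lemma sr_theta_mem (n : ℕ) (k : Type) [Field k] (G : Subgroup (Equiv.Perm (Fin n))) (i : ℕ)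
    (hi : 1 ≤ i) : SRtheta n k i ∈ SRinvariant n k G := by
  intro g _
  obtain ⟨φ, hφ⟩ := sr_exists n k
  apply φ.injective
  rw [sr_equivariant φ hφ, (sr_theta φ hφ i hi).1]
  exact rename_esymm (Fin n) k i g

lemma sr_esymm_mem (n : ℕ) (k : Type) [Field k] (G : Subgroup (Equiv.Perm (Fin n))) (i : ℕ) :
    esymm (Fin n) k i ∈ invariantRing k n G := by
  intro g _
  exact rename_esymm (Fin n) k i g

lemma sr_range {k : Type} [Field k] {n : ℕ} {C : Type} [CommRing C] [Algebra k C]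
    (B : Subalgebra k C) (t : ℕ → C) (ht : ∀ i, 1 ≤ i → t i ∈ B) :
    Algebra.adjoin k {a : B | ∃ i : ℕ, 1 ≤ i ∧ i ≤ n ∧ (a : C) = t i} =
      (aeval (R := k) (fun i : Fin n => (⟨t (i + 1), ht _ (by omega)⟩ : B))).range := by
  rw [← Algebra.adjoin_range_eq_range_aeval]
  congr 1
  ext a
  constructor
  · rintro ⟨i, h1, h2, h3⟩
    refine ⟨⟨i - 1, by omega⟩, Subtype.ext ?_⟩
    rw [h3]
    show t (i - 1 + 1) = t i
    rw [Nat.sub_add_cancel h1]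
  · rintro ⟨i, rfl⟩
    exact ⟨i + 1, by omega, by omega, rfl⟩

lemma sr_inj {k : Type} [Field k] {n : ℕ} {C : Type} [CommRing C] [Algebra k C]
    (B : Subalgebra k C) (t : Fin n → C) (ht : ∀ i, t i ∈ B)
    (h : Function.Injective (aeval (R := k) t)) :
    Function.Injective (aeval (R := k) (fun i : Fin n => (⟨t i, ht i⟩ : B))) := by
  have : B.val.comp (aeval (R := k) (fun i : Fin n => (⟨t i, ht i⟩ : B))) = aeval t := by
    ext1 i; simp
  rw [← this, AlgHom.coe_comp] at h
  exact h.of_comp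

lemma sr_esymm_inj (n : ℕ) (k : Type) [Field k] :
    Function.Injective (aeval (R := k) (fun i : Fin n => esymm (Fin n) k (i + 1))) := by
  intro p q h
  apply esymmAlgHom_fin_injective (R := k) (le_refl n)
  apply Subtype.ext
  rw [esymmAlgHom_apply, esymmAlgHom_apply]
  exact h

lemma sr_main (n : ℕ) (k : Type) [Field k]
    (G : Subgroup (Equiv.Perm (Fin n)))
    (h : Module.Free (SRthetaSubalgebra n k G) (SRinvariant n k G)) :
    Module.Free (esymmSubalgebra k n G) (invariantRing k n G) := by
  obtain ⟨φ, hφ⟩ := sr_exists n k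
  have hθ : ∀ i : Fin n, SRtheta n k (i + 1) ∈ SRinvariant n k G := fun i =>
    sr_theta_mem n k G _ (by omega)
  have he : ∀ i : Fin n, esymm (Fin n) k (i + 1) ∈ invariantRing k n G := fun i =>
    sr_esymm_mem n k G _
  let f₁ : MvPolynomial (Fin n) k →ₐ[k] SRinvariant n k G :=
    aeval (fun i : Fin n => (⟨SRtheta n k (i + 1), hθ i⟩ : SRinvariant n k G))
  let f₂ : MvPolynomial (Fin n) k →ₐ[k] invariantRing k n G :=
    aeval (fun i : Fin n => (⟨esymm (Fin n) k (i + 1), he i⟩ : invariantRing k n G))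
  have hf₁ : Function.Injective f₁ := sr_inj _ _ hθ (sr_theta_indep n k)
  have hf₂ : Function.Injective f₂ := sr_inj _ _ he (sr_esymm_inj n k)
  have hr₁ : SRthetaSubalgebra n k G = f₁.range :=
    sr_range (SRinvariant n k G) (SRtheta n k) (sr_theta_mem n k G)
  have hr₂ : esymmSubalgebra k n G = f₂.range :=
    sr_range (invariantRing k n G) (esymm (Fin n) k) (fun i _ => sr_esymm_mem n k G i)
  rw [sr_transfer f₁ hf₁ _ hr₁] at h
  rw [sr_transfer f₂ hf₂ _ hr₂]
  letI i₁ : Module (MvPolynomial (Fin n) k) (SRinvariant n k G) :=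
    Module.compHom _ f₁.toRingHom
  letI i₂ : Module (MvPolynomial (Fin n) k) (invariantRing k n G) :=
    Module.compHom _ f₂.toRingHom
  have hs₁ : ∀ (a : MvPolynomial (Fin n) k) (m : SRinvariant n k G), a • m = f₁ a * m :=
    fun _ _ => rfl
  have hs₂ : ∀ (a : MvPolynomial (Fin n) k) (m : invariantRing k n G), a • m = f₂ a * m :=
    fun _ _ => rfl
  haveI : IsScalarTower k (MvPolynomial (Fin n) k) (SRinvariant n k G) :=
    ⟨fun c a m => by rw [hs₁, hs₁, map_smul, smul_mul_assoc]⟩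
  haveI : IsScalarTower k (MvPolynomial (Fin n) k) (invariantRing k n G) :=
    ⟨fun c a m => by rw [hs₂, hs₂, map_smul, smul_mul_assoc]⟩
  have hX₁ : ∀ i (m : SRinvariant n k G), (((X i : MvPolynomial (Fin n) k) • m :
      SRinvariant n k G) : SRRing n k) = SRtheta n k (i + 1) * m := by
    intro i m
    rw [hs₁, aeval_X]; rfl
  have hX₂ : ∀ i (m : invariantRing k n G), (((X i : MvPolynomial (Fin n) k) • m :
      invariantRing k n G) : MvPolynomial (Fin n) k) = esymm (Fin n) k (i + 1) * m := by
    intro i m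
    rw [hs₂, aeval_X]; rfl
  have hφG : ∀ r, r ∈ SRinvariant n k G → φ r ∈ invariantRing k n G := by
    intro r hr g hg
    rw [← sr_equivariant φ hφ, hr g hg]
  have hφG' : ∀ p, p ∈ invariantRing k n G → φ.symm p ∈ SRinvariant n k G := by
    intro p hp g hg
    apply φ.injective
    rw [sr_equivariant φ hφ, φ.apply_symm_apply, hp g hg]
  have hprG : ∀ d p, p ∈ invariantRing k n G → srPr d p ∈ invariantRing k n G := by
    intro d p hp g hg
    rw [← srPr_rename, hp g hg]
  let φ' : SRinvariant n k G ≃ₗ[k] invariantRing k n G :=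
    { toFun := fun r => ⟨φ r.1, hφG _ r.2⟩
      invFun := fun p => ⟨φ.symm p.1, hφG' _ p.2⟩
      map_add' := fun x y => Subtype.ext (map_add φ x.1 y.1)
      map_smul' := fun c x => Subtype.ext (map_smul φ c x.1)
      left_inv := fun x => Subtype.ext (φ.symm_apply_apply x.1)
      right_inv := fun x => Subtype.ext (φ.apply_symm_apply x.1) }
  have hφ'1 : ∀ r, ((φ' r : invariantRing k n G) : MvPolynomial (Fin n) k) = φ r := fun _ => rfl
  have hφ'2 : ∀ r, ((φ'.symm r : SRinvariant n k G) : SRRing n k) = φ.symm r := fun _ => rfl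
  let π : ℕ → SRinvariant n k G →ₗ[k] SRinvariant n k G := fun d =>
    { toFun := fun r => ⟨φ.symm (srPr d (φ r.1)), hφG' _ (hprG d _ (hφG _ r.2))⟩
      map_add' := fun x y => Subtype.ext (by simp)
      map_smul' := fun c x => Subtype.ext (by simp) }
  have hπ : ∀ d r, ((π d r : SRinvariant n k G) : SRRing n k) = φ.symm (srPr d (φ r)) :=
    fun _ _ => rfl
  have hinj : ∀ x y : SRinvariant n k G, φ x = φ y → x = y := fun x y hxy =>
    Subtype.ext (φ.injective hxy)
  have key : ∀ (i : Fin n) (d : ℕ) (m : SRinvariant n k G), π d m = m →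
      srPr (d + ((i + 1) * n + (n - (i + 1)) * (i + 1))) (φ (SRtheta n k (i + 1) * m)) =
        φ (SRtheta n k (i + 1) * m) ∧
      ∀ e, d + ((i + 1) * n + (n - (i + 1)) * (i + 1)) ≤ e →
        srPr e (esymm (Fin n) k (i + 1) * φ m - φ (SRtheta n k (i + 1) * m)) = 0 := by
    intro i d m hm
    have h1 := sr_mul φ hφ ((i + 1) * n + (n - (i + 1)) * (i + 1)) d
      (esymm (Fin n) k (i + 1)) (φ m)
    obtain ⟨t1, t2⟩ := sr_theta φ hφ (i + 1) (by omega)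
    have h2 : srPr d (φ m) = φ m := by
      have := congrArg (fun x : SRinvariant n k G => φ x) hm
      simpa only [hπ, φ.apply_symm_apply] using this
    rw [t2, h2, ← t1, φ.symm_apply_apply, φ.symm_apply_apply, add_comm _ d, t1] at h1
    exact h1
  refine aux_abstract π ?_ ?_ ?_ (fun i : Fin n => (i + 1) * n + (n - (i + 1)) * (i + 1)) ?_ ?_
    φ' ?_ h
  · intro d m
    apply hinj
    simp only [hπ, φ.apply_symm_apply, srPr_idem]
  · intro d e m hde
    apply hinj
    simp only [hπ, φ.apply_symm_apply, srPr_orth d e _ hde, ZeroMemClass.coe_zero, map_zero]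
  · intro m
    obtain ⟨N, hN⟩ := srPr_sum (φ m)
    refine ⟨N, ?_⟩
    apply hinj
    rw [AddSubmonoidClass.coe_finsetSum, map_sum]
    simp only [hπ, φ.apply_symm_apply]
    exact hN N le_rfl
  · intro i
    have : 0 < n := by have := i.2; omega
    positivity
  · intro i d m hm
    apply hinj
    rw [hπ, φ.apply_symm_apply, hX₁]
    exact (key i d m hm).1
  · intro i d m hm e hle
    apply hinj
    rw [hπ, φ.apply_symm_apply, AddSubgroupClass.coe_sub, map_sub, hφ'2, φ.apply_symm_apply,
      hX₁, hX₂, hφ'1, (key i d m hm).2 e hle]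
    simp

end SRAux

/-- Reiner's appendix theorem: if the invariant subring `R^G` of the
Stanley–Reisner ring of `B_n` minus its bottom element is free over the
subalgebra generated by `θ_1,…,θ_n` (i.e. `k[Δ(B_n)]^G` is Cohen-Macaulay over
`k`), then the invariant polynomial ring `k[x_1,…,x_n]^G` is free over the
subalgebra generated by the elementary symmetric polynomials `e_1,…,e_n`
(i.e. `k[x_1,…,x_n]^G` is Cohen-Macaulay over `k`). -/
theorem invariant_polynomialRing_free_of_SR_invariant_free
    (n : ℕ) (hn : 1 ≤ n) (k : Type) [Field k]
    (G : Subgroup (Equiv.Perm (Fin n)))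
    (h : Module.Free (SRthetaSubalgebra n k G) (SRinvariant n k G)) :
    Module.Free (esymmSubalgebra k n G) (invariantRing k n G) := by
  exact sr_main n k G h
end

section
/- (Transfer map, appendix.) Let n ≥ 1 and let k be a field. Let R = (MvPolynomial V k)/I be the Stanley–Reisner ring of the Boolean algebra B_n minus its bottom element, where V = {S : Finset (Fin n) // S.Nonempty} and I is the ideal generated by all products y_S·y_T with S, T incomparable, graded by assigning y_S degree |S|. Then there exists a k-linear equivalence T : R ≃ MvPolynomial (Fin n) k such that: (1) for every multichain S_1 ⊆ S_2 ⊆ ⋯ ⊆ S_r of nonempty subsets of Fin n, T maps the image in R of the monomial y_{S_1}·y_{S_2}⋯y_{S_r} to the monomial ∏_{j=1}^r ∏_{i∈S_j} x_i; (2) T is equivariant for the actions of the full symmetric group Equiv.Perm (Fin n) (acting on R via g•y_S = y_{g(S)} and on polynomials by permuting variables); and (3) T maps the degree-d homogeneous component of R onto the homogeneous polynomials of degree d, for every d. -/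
set_option synthInstance.maxHeartbeats 1000000
set_option maxHeartbeats 1000000


/-- The degree-`d` homogeneous component of the Stanley–Reisner ring, for the
grading in which `y_S` has degree `|S|`: the image in the quotient of the
submodule of weighted homogeneous polynomials of weighted degree `d`. -/
noncomputable def SRdegComponent (n : ℕ) (k : Type) [CommRing k] (d : ℕ) :
    Submodule k (SRRing n k) :=
  Submodule.map (Ideal.Quotient.mkₐ k (SRIdeal n k)).toLinearMap
    (MvPolynomial.weightedHomogeneousSubmodule k
      (fun S : SRVertex n => S.1.card) d)

namespace SRTransfer

open MvPolynomial

/-- exponent vector of the indicator of `S` -/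
noncomputable def ind (n : ℕ) (S : SRVertex n) : Fin n →₀ ℕ := ∑ i ∈ S.1, Finsupp.single i 1

lemma ind_apply {n : ℕ} (S : SRVertex n) (i : Fin n) : ind n S i = if i ∈ S.1 then 1 else 0 := by
  simp [ind, Finsupp.finsetSum_apply, Finsupp.single_apply]

/-- total exponent -/
noncomputable def phi (n : ℕ) : (SRVertex n →₀ ℕ) →ₗ[ℕ] (Fin n →₀ ℕ) :=
  Finsupp.linearCombination ℕ (ind n)

lemma phi_single {n : ℕ} (S : SRVertex n) (m : ℕ) :
    phi n (Finsupp.single S m) = m • ind n S := by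
  simp [phi]

/-- the support is a chain -/
def Ch {n : ℕ} (a : SRVertex n →₀ ℕ) : Prop :=
  ∀ S T : SRVertex n, a S ≠ 0 → a T ≠ 0 → S.1 ⊆ T.1 ∨ T.1 ⊆ S.1

lemma phi_ne {n : ℕ} (a : SRVertex n →₀ ℕ) (i : Fin n) :
    phi n a i ≠ 0 ↔ ∃ S : SRVertex n, a S ≠ 0 ∧ i ∈ S.1 := by
  rw [phi, Finsupp.linearCombination_apply, Finsupp.sum, Finsupp.finsetSum_apply, Ne,
    Finset.sum_eq_zero_iff]
  push Not
  constructor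
  · rintro ⟨S, hS, h⟩
    refine ⟨S, by simpa using hS, ?_⟩
    by_contra hi
    apply h
    simp [ind_apply, hi]
  · rintro ⟨S, hS, h⟩
    exact ⟨S, by simpa using hS, by simp [ind_apply, h, hS]⟩

lemma decomp {n : ℕ} (a : SRVertex n →₀ ℕ) (ha : Ch a) (h0 : a ≠ 0) :
    ∃ (T : SRVertex n) (a' : SRVertex n →₀ ℕ), a = Finsupp.single T 1 + a' ∧ Ch a' ∧
      (phi n a).support = T.1 := by
  obtain ⟨T, hT, hmax⟩ := Finset.exists_max_image a.support (fun S => S.1.card)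
    (Finsupp.support_nonempty_iff.mpr h0)
  have hT' : a T ≠ 0 := by simpa using hT
  have hsub : ∀ S : SRVertex n, a S ≠ 0 → S.1 ⊆ T.1 := by
    intro S hS
    rcases ha S T hS hT' with h | h
    · exact h
    · exact (Finset.eq_of_subset_of_card_le h (hmax S (by simpa using hS))).symm.subset
  refine ⟨T, a - Finsupp.single T 1, ?_, ?_, ?_⟩
  · rw [add_tsub_cancel_of_le]
    rw [Finsupp.single_le_iff]
    omega
  · intro S U hS hU
    simp only [Finsupp.tsub_apply] at hS hU
    exact ha S U (by omega) (by omega)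
  · ext i
    rw [Finsupp.mem_support_iff, phi_ne]
    constructor
    · rintro ⟨S, hS, hi⟩
      exact hsub S hS hi
    · intro hi
      exact ⟨T, hT', hi⟩

lemma phi_inj {n : ℕ} : ∀ (m : ℕ) (a b : SRVertex n →₀ ℕ), a.degree = m → Ch a → Ch b →
    phi n a = phi n b → a = b := by
  intro m
  induction m with
  | zero =>
    intro a b hm ha hb h
    rw [Finsupp.degree_eq_zero_iff] at hm
    subst hm
    by_contra hne
    obtain ⟨T, b', -, -, hT⟩ := decomp b hb (Ne.symm hne)
    rw [← h] at hT
    simp only [map_zero, Finsupp.support_zero] at hT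
    exact T.2.ne_empty hT.symm
  | succ m ih =>
    intro a b hm ha hb h
    have ha0 : a ≠ 0 := by
      rintro rfl
      simp at hm
    obtain ⟨T, a', rfl, ha', hT⟩ := decomp a ha ha0
    have hb0 : b ≠ 0 := by
      rintro rfl
      rw [h] at hT
      simp only [map_zero, Finsupp.support_zero] at hT
      exact T.2.ne_empty hT.symm
    obtain ⟨U, b', rfl, hb', hU⟩ := decomp b hb hb0
    have hTU : T = U := Subtype.ext (by rw [← hT, ← hU, h])
    subst hTU
    rw [map_add, map_add] at h
    rw [map_add, Finsupp.degree_single] at hm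
    rw [ih a' b' (by omega) ha' hb' (add_left_cancel h)]

lemma phi_surj {n : ℕ} : ∀ (m : ℕ) (e : Fin n →₀ ℕ), e.degree = m →
    ∃ a : SRVertex n →₀ ℕ, Ch a ∧ phi n a = e := by
  intro m
  induction m using Nat.strong_induction_on with
  | _ m ih =>
    intro e hm
    by_cases he : e = 0
    · exact ⟨0, fun S T h => by simp at h, by simp [he]⟩
    · let T : SRVertex n := ⟨e.support, Finsupp.support_nonempty_iff.mpr he⟩
      have hle : ind n T ≤ e := by
        intro i
        rw [ind_apply]
        split_ifs with h
        · have : e i ≠ 0 := by simpa [T] using h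
          omega
        · omega
      have heq : ind n T + (e - ind n T) = e := add_tsub_cancel_of_le hle
      have hpos : (ind n T).degree ≠ 0 := by
        rw [Ne, Finsupp.degree_eq_zero_iff]
        intro h0
        obtain ⟨i, hi⟩ := T.2
        have := DFunLike.congr_fun h0 i
        rw [ind_apply, if_pos hi] at this
        simp at this
      have hdeg : (ind n T).degree + (e - ind n T).degree = m := by
        rw [← map_add, heq, hm]
      obtain ⟨a, ha, hphi⟩ := ih _ (by omega) (e - ind n T) rfl
      have hsub : ∀ S : SRVertex n, a S ≠ 0 → S.1 ⊆ T.1 := by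
        intro S hS i hi
        have h1 := (phi_ne a i).2 ⟨S, hS, hi⟩
        rw [hphi, Finsupp.tsub_apply] at h1
        simp only [T, Finsupp.mem_support_iff]
        omega
      refine ⟨Finsupp.single T 1 + a, ?_, ?_⟩
      · have key : ∀ S : SRVertex n, (Finsupp.single T 1 + a : SRVertex n →₀ ℕ) S ≠ 0 → S = T ∨ a S ≠ 0 := by
          intro S hS
          by_cases h : S = T
          · exact Or.inl h
          · right
            simpa [Finsupp.single_apply, Ne.symm h] using hS
        intro S U hS hU
        rcases key S hS with rfl | hS
        · rcases key U hU with rfl | hU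
          · exact Or.inl subset_rfl
          · exact Or.inr (hsub U hU)
        · rcases key U hU with rfl | hU
          · exact Or.inl (hsub S hS)
          · exact ha S U hS hU
      · rw [map_add, phi_single, one_smul, hphi, heq]

/-- inverse of `phi` -/
noncomputable def psi {n : ℕ} (e : Fin n →₀ ℕ) : SRVertex n →₀ ℕ :=
  (phi_surj _ e rfl).choose

lemma psi_ch {n : ℕ} (e : Fin n →₀ ℕ) : Ch (psi e) := (phi_surj _ e rfl).choose_spec.1

lemma phi_psi {n : ℕ} (e : Fin n →₀ ℕ) : phi n (psi e) = e := (phi_surj _ e rfl).choose_spec.2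

lemma psi_phi {n : ℕ} (a : SRVertex n →₀ ℕ) (ha : Ch a) : psi (phi n a) = a :=
  phi_inj _ _ _ rfl (psi_ch _) ha (phi_psi _)

open Classical in
/-- the transfer map on the polynomial ring -/
noncomputable def L (n : ℕ) (k : Type) [Field k] :
    MvPolynomial (SRVertex n) k →ₗ[k] MvPolynomial (Fin n) k :=
  (basisMonomials (SRVertex n) k).constr k
    (fun a => if Ch a then monomial (phi n a) 1 else 0)

lemma L_monomial {n : ℕ} {k : Type} [Field k] (a : SRVertex n →₀ ℕ) (c : k) (ha : Ch a) :
    L n k (monomial a c) = monomial (phi n a) c := by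
  have h1 : (monomial a c : MvPolynomial (SRVertex n) k) =
      c • basisMonomials (SRVertex n) k a := by
    simp [smul_monomial]
  rw [h1, map_smul, L, Module.Basis.constr_basis, if_pos ha, smul_monomial]
  simp

lemma L_monomial_not {n : ℕ} {k : Type} [Field k] (a : SRVertex n →₀ ℕ) (c : k) (ha : ¬ Ch a) :
    L n k (monomial a c) = 0 := by
  have h1 : (monomial a c : MvPolynomial (SRVertex n) k) =
      c • basisMonomials (SRVertex n) k a := by
    simp [smul_monomial]
  rw [h1, map_smul, L, Module.Basis.constr_basis, if_neg ha, smul_zero]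

lemma L_ideal {n : ℕ} {k : Type} [Field k] (p : MvPolynomial (SRVertex n) k)
    (hp : p ∈ SRIdeal n k) : L n k p = 0 := by
  rw [SRIdeal] at hp
  refine Submodule.span_induction (p := fun p _ => ∀ q, L n k (q * p) = 0) ?_ ?_ ?_ ?_ hp 1
    |> fun h => by simpa using h
  · rintro x ⟨S, T, h1, h2, rfl⟩ q
    have hX : (X S * X T : MvPolynomial (SRVertex n) k) =
      monomial (Finsupp.single S 1 + Finsupp.single T 1) 1 := by
      simp [X, monomial_mul]
    rw [hX, q.as_sum, Finset.sum_mul, map_sum]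
    refine Finset.sum_eq_zero fun a _ => ?_
    rw [monomial_mul]
    apply L_monomial_not
    intro h
    rcases h S T (by simp) (by simp) with h | h
    · exact h1 h
    · exact h2 h
  · intro q
    simp
  · intro x y _ _ hx hy q
    rw [mul_add, map_add, hx, hy, add_zero]
  · intro r x _ hx q
    rw [smul_eq_mul, ← mul_assoc, hx]

lemma mk_monomial_not {n : ℕ} {k : Type} [Field k] (a : SRVertex n →₀ ℕ) (c : k) (ha : ¬ Ch a) :
    (monomial a c : MvPolynomial (SRVertex n) k) ∈ SRIdeal n k := by
  unfold Ch at ha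
  push Not at ha
  obtain ⟨S, T, hS, hT, h1, h2⟩ := ha
  have hne : S ≠ T := by
    rintro rfl
    exact h1 subset_rfl
  have hle : Finsupp.single S 1 + Finsupp.single T 1 ≤ a := by
    intro U
    simp only [Finsupp.add_apply, Finsupp.single_apply]
    split_ifs with h h' h'
    · exact absurd (h.trans h'.symm) hne
    · subst h; omega
    · subst h'; omega
    · omega
  have : (monomial a c : MvPolynomial (SRVertex n) k) =
      monomial (a - (Finsupp.single S 1 + Finsupp.single T 1)) c * (X S * X T) := by
    simp only [X, monomial_mul, mul_one]
    rw [tsub_add_cancel_of_le hle]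
  rw [this]
  exact Ideal.mul_mem_left _ _ (Ideal.subset_span ⟨S, T, h1, h2, rfl⟩)

/-- forward map -/
noncomputable def F (n : ℕ) (k : Type) [Field k] :
    SRRing n k →ₗ[k] MvPolynomial (Fin n) k :=
  Submodule.liftQ ((SRIdeal n k).restrictScalars k) (L n k)
    (fun p hp => L_ideal p hp)

lemma F_mk {n : ℕ} {k : Type} [Field k] (p : MvPolynomial (SRVertex n) k) :
    F n k (Ideal.Quotient.mk (SRIdeal n k) p) = L n k p := rfl

/-- backward map -/
noncomputable def M (n : ℕ) (k : Type) [Field k] :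
    MvPolynomial (Fin n) k →ₗ[k] SRRing n k :=
  (Ideal.Quotient.mkₐ k (SRIdeal n k)).toLinearMap ∘ₗ
    (basisMonomials (Fin n) k).constr k
      (fun e => (monomial (psi e) 1 : MvPolynomial (SRVertex n) k))

lemma M_monomial {n : ℕ} {k : Type} [Field k] (e : Fin n →₀ ℕ) (c : k) :
    M n k (monomial e c) = Ideal.Quotient.mk (SRIdeal n k) (monomial (psi e) c) := by
  have h1 : (monomial e c : MvPolynomial (Fin n) k) = c • basisMonomials (Fin n) k e := by
    simp [smul_monomial]
  rw [h1, M, LinearMap.comp_apply, map_smul, Module.Basis.constr_basis, smul_monomial]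
  simp

lemma F_M {n : ℕ} {k : Type} [Field k] (q : MvPolynomial (Fin n) k) : F n k (M n k q) = q := by
  rw [q.as_sum, map_sum, map_sum]
  refine Finset.sum_congr rfl fun e _ => ?_
  rw [M_monomial, F_mk, L_monomial _ _ (psi_ch e), phi_psi]

lemma M_F {n : ℕ} {k : Type} [Field k] (x : SRRing n k) : M n k (F n k x) = x := by
  obtain ⟨p, rfl⟩ := Ideal.Quotient.mk_surjective x
  rw [F_mk]
  rw [p.as_sum, map_sum, map_sum, map_sum]
  refine Finset.sum_congr rfl fun a _ => ?_
  by_cases ha : Ch a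
  · rw [L_monomial _ _ ha, M_monomial, psi_phi _ ha]
  · rw [L_monomial_not _ _ ha, map_zero, eq_comm, Ideal.Quotient.eq_zero_iff_mem]
    exact mk_monomial_not _ _ ha

/-- the transfer equivalence -/
noncomputable def T (n : ℕ) (k : Type) [Field k] :
    SRRing n k ≃ₗ[k] MvPolynomial (Fin n) k :=
  LinearEquiv.ofLinear (F n k) (M n k) (LinearMap.ext F_M) (LinearMap.ext M_F)

lemma T_mk {n : ℕ} {k : Type} [Field k] (p : MvPolynomial (SRVertex n) k) :
    T n k (Ideal.Quotient.mk (SRIdeal n k) p) = L n k p := rfl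

lemma perm_inj {n : ℕ} (g : Equiv.Perm (Fin n)) : Function.Injective (SRpermVertex n g) := by
  intro S U h
  have := congrArg Subtype.val h
  exact Subtype.ext (Finset.image_injective g.injective this)

lemma Ch_map {n : ℕ} (g : Equiv.Perm (Fin n)) (a : SRVertex n →₀ ℕ) :
    Ch (a.mapDomain (SRpermVertex n g)) ↔ Ch a := by
  have hsub : ∀ S U : SRVertex n, (SRpermVertex n g S).1 ⊆ (SRpermVertex n g U).1 ↔ S.1 ⊆ U.1 :=
    fun S U => Finset.image_subset_image_iff g.injective
  constructor
  · intro h S U hS hU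
    have := h (SRpermVertex n g S) (SRpermVertex n g U)
      (by rwa [Finsupp.mapDomain_apply (perm_inj g)])
      (by rwa [Finsupp.mapDomain_apply (perm_inj g)])
    rwa [hsub, hsub] at this
  · intro h S U hS hU
    have key : ∀ S : SRVertex n, a.mapDomain (SRpermVertex n g) S ≠ 0 →
        ∃ S', SRpermVertex n g S' = S := by
      intro S hS
      by_contra hc
      exact hS (Finsupp.mapDomain_notin_range _ _ hc)
    obtain ⟨S, rfl⟩ := key S hS
    obtain ⟨U, rfl⟩ := key U hU
    rw [Finsupp.mapDomain_apply (perm_inj g)] at hS hU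
    rw [hsub, hsub]
    exact h S U hS hU

lemma phi_map {n : ℕ} (g : Equiv.Perm (Fin n)) (a : SRVertex n →₀ ℕ) :
    phi n (a.mapDomain (SRpermVertex n g)) = (phi n a).mapDomain g := by
  induction a using Finsupp.induction_linear with
  | zero => simp
  | add a b ha hb => simp only [Finsupp.mapDomain_add, map_add, ha, hb]
  | single S m =>
    rw [Finsupp.mapDomain_single, phi_single, phi_single, Finsupp.mapDomain_smul]
    congr 1
    simp only [ind, SRpermVertex, Finsupp.mapDomain_finset_sum, Finsupp.mapDomain_single]
    rw [Finset.sum_image (fun x _ y _ h => g.injective h)]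

lemma degree_phi {n : ℕ} (a : SRVertex n →₀ ℕ) :
    (phi n a).degree = Finsupp.weight (fun S : SRVertex n => S.1.card) a := by
  induction a using Finsupp.induction_linear with
  | zero => simp
  | add a b ha hb => simp only [map_add, ha, hb]
  | single S m =>
    rw [phi_single, map_nsmul, Finsupp.weight_single]
    simp [ind, map_sum]

end SRTransfer

/-- The transfer map of Garsia–Stanton: a `k`-linear equivalence from the
Stanley–Reisner ring `R` of `B_n` minus its bottom element to the polynomial
ring `k[x_1,…,x_n]`, sending (the class of) a monomial `y_{S_1} ⋯ y_{S_r}`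
supported on a multichain `S_1 ⊆ ⋯ ⊆ S_r` to `∏_j ∏_{i ∈ S_j} x_i`, which is
equivariant for the `S_n`-actions and maps the degree-`d` component of `R`
onto the homogeneous polynomials of degree `d` for each `d`. -/
theorem exists_transfer_map (n : ℕ) (hn : 1 ≤ n) (k : Type) [Field k] :
    ∃ T : SRRing n k ≃ₗ[k] MvPolynomial (Fin n) k,
      (∀ (r : ℕ) (S : Fin r → SRVertex n),
          (∀ a b : Fin r, a ≤ b → (S a).1 ⊆ (S b).1) →
          T (Ideal.Quotient.mk (SRIdeal n k) (∏ j, MvPolynomial.X (S j))) =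
            ∏ j, ∏ i ∈ (S j).1, MvPolynomial.X i) ∧
      (∀ (g : Equiv.Perm (Fin n)) (x : SRRing n k),
          T (SRmap n k g x) = MvPolynomial.rename (⇑g) (T x)) ∧
      (∀ d : ℕ, Submodule.map (T : SRRing n k →ₗ[k] MvPolynomial (Fin n) k)
          (SRdegComponent n k d) = MvPolynomial.homogeneousSubmodule (Fin n) k d) := by
  refine ⟨SRTransfer.T n k, ?_, ?_, ?_⟩
  · intro r S hS
    have h1 : (∏ j, MvPolynomial.X (S j) : MvPolynomial (SRVertex n) k) =
        MvPolynomial.monomial (∑ j, Finsupp.single (S j) 1) 1 := by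
      rw [MvPolynomial.monomial_sum_one]
      rfl
    have hch : SRTransfer.Ch (∑ j, Finsupp.single (S j) 1) := by
      have key : ∀ U : SRVertex n, (∑ j, Finsupp.single (S j) 1 : SRVertex n →₀ ℕ) U ≠ 0 →
          ∃ j, S j = U := by
        intro U hU
        by_contra hc
        push Not at hc
        apply hU
        rw [Finsupp.finsetSum_apply]
        apply Finset.sum_eq_zero
        intro j _
        simp [Finsupp.single_apply, hc j]
      intro U W hU hW
      obtain ⟨a, rfl⟩ := key U hU
      obtain ⟨b, rfl⟩ := key W hW
      rcases le_total a b with h | h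
      · exact Or.inl (hS a b h)
      · exact Or.inr (hS b a h)
    rw [h1, SRTransfer.T_mk, SRTransfer.L_monomial _ _ hch, map_sum, MvPolynomial.monomial_sum_one]
    refine Finset.prod_congr rfl fun j _ => ?_
    rw [SRTransfer.phi_single, one_smul, SRTransfer.ind, MvPolynomial.monomial_sum_one]
    rfl
  · intro g x
    obtain ⟨p, rfl⟩ := Ideal.Quotient.mk_surjective x
    rw [SRmap, Ideal.quotientMap_mk, SRTransfer.T_mk, SRTransfer.T_mk]
    change SRTransfer.L n k (MvPolynomial.rename (SRpermVertex n g) p) = _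
    rw [p.as_sum, map_sum, map_sum, map_sum, map_sum]
    refine Finset.sum_congr rfl fun a _ => ?_
    rw [MvPolynomial.rename_monomial]
    by_cases ha : SRTransfer.Ch a
    · rw [SRTransfer.L_monomial _ _ ha, MvPolynomial.rename_monomial,
        SRTransfer.L_monomial _ _ ((SRTransfer.Ch_map g a).2 ha), SRTransfer.phi_map]
    · rw [SRTransfer.L_monomial_not _ _ ha, map_zero,
        SRTransfer.L_monomial_not _ _ (fun h => ha ((SRTransfer.Ch_map g a).1 h))]
  · intro d
    apply le_antisymm
    · rw [SRdegComponent]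
      rintro _ ⟨_, ⟨p, hp, rfl⟩, rfl⟩
      change SRTransfer.L n k p ∈ _
      have hp' : MvPolynomial.IsWeightedHomogeneous (fun S : SRVertex n => S.1.card) p d := hp
      rw [p.as_sum, map_sum]
      refine Submodule.sum_mem _ fun a ha => ?_
      by_cases hc : SRTransfer.Ch a
      · rw [SRTransfer.L_monomial _ _ hc, MvPolynomial.mem_homogeneousSubmodule]
        apply MvPolynomial.isHomogeneous_monomial
        rw [SRTransfer.degree_phi]
        exact hp' (MvPolynomial.mem_support_iff.mp ha)
      · rw [SRTransfer.L_monomial_not _ _ hc]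
        exact Submodule.zero_mem _
    · intro q hq
      rw [MvPolynomial.mem_homogeneousSubmodule] at hq
      rw [q.as_sum]
      refine Submodule.sum_mem _ fun e he => ?_
      refine ⟨Ideal.Quotient.mk (SRIdeal n k)
        (MvPolynomial.monomial (SRTransfer.psi e) (MvPolynomial.coeff e q)),
        ⟨_, ?_, rfl⟩, ?_⟩
      · apply MvPolynomial.isWeightedHomogeneous_monomial
        rw [← SRTransfer.degree_phi, SRTransfer.phi_psi]
        have := hq (MvPolynomial.mem_support_iff.mp he)
        rw [Finsupp.degree_eq_weight_one]
        exact this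
      · change SRTransfer.L n k _ = _
        rw [SRTransfer.L_monomial _ _ (SRTransfer.psi_ch e), SRTransfer.phi_psi]
end

section
/- (Equality of Hilbert series, appendix.) Let n ≥ 1, let k be a field, and let G be a subgroup of Equiv.Perm (Fin n). Let R = (MvPolynomial V k)/I be the Stanley–Reisner ring of the Boolean algebra B_n minus its bottom element, where V = {S : Finset (Fin n) // S.Nonempty} and I is the ideal generated by all products y_S·y_T with S, T incomparable, graded by assigning y_S degree |S|, with G acting via g•y_S = y_{g(S)}. Then for every degree d ≥ 0, the k-vector space of G-fixed elements in the degree-d homogeneous component of R has the same (finite) dimension as the k-vector space of G-fixed homogeneous polynomials of degree d in MvPolynomial (Fin n) k; that is, the invariant rings R^G and k[x_1,…,x_n]^G have the same Hilbert series. -/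
set_option synthInstance.maxHeartbeats 1000000
set_option maxHeartbeats 1000000


/-- The `k`-submodule of `G`-fixed elements of the Stanley–Reisner ring. -/
noncomputable def SRfixedSubmodule (n : ℕ) (k : Type) [CommRing k]
    (G : Subgroup (Equiv.Perm (Fin n))) : Submodule k (SRRing n k) where
  carrier := { r | ∀ g ∈ G, SRmap n k g r = r }
  add_mem' := by
    intro p q hp hq g hg
    rw [map_add, hp g hg, hq g hg]
  zero_mem' := by
    intro g hg
    rw [map_zero]
  smul_mem' := by
    intro c r hr g hg
    have h1 : c • r = algebraMap k (SRRing n k) c * r := (Algebra.smul_def c r)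
    have h2 : (algebraMap k (SRRing n k)) c =
        Ideal.Quotient.mk (SRIdeal n k) (MvPolynomial.C c) := rfl
    rw [h1, map_mul, hr g hg, h2, SRmap, Ideal.quotientMap_mk]
    simp [MvPolynomial.rename_C, Algebra.smul_def]

/-- The `k`-submodule of `G`-fixed polynomials in `k[x_1,…,x_n]`. -/
noncomputable def polyFixedSubmodule (n : ℕ) (k : Type) [CommRing k]
    (G : Subgroup (Equiv.Perm (Fin n))) : Submodule k (MvPolynomial (Fin n) k) where
  carrier := { p | ∀ g ∈ G, MvPolynomial.rename (⇑g) p = p }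
  add_mem' := by
    intro p q hp hq g hg
    rw [map_add, hp g hg, hq g hg]
  zero_mem' := by
    intro g hg
    rw [map_zero]
  smul_mem' := by
    intro c p hp g hg
    rw [map_smul, hp g hg]

/-- indicator exponent vector of a set -/
noncomputable def SRind (n : ℕ) (S : SRVertex n) : Fin n →₀ ℕ :=
  ∑ i ∈ S.1, Finsupp.single i 1

lemma SRind_apply (n : ℕ) (S : SRVertex n) (i : Fin n) :
    SRind n S i = if i ∈ S.1 then 1 else 0 := by
  simp [SRind, Finsupp.finset_sum_apply, Finsupp.single_apply]

/-- exponent vector of a monomial in the `y_S` -/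
noncomputable def SRexp (n : ℕ) : (SRVertex n →₀ ℕ) →ₗ[ℕ] (Fin n →₀ ℕ) :=
  Finsupp.linearCombination ℕ (SRind n)

lemma SRexp_single (n : ℕ) (S : SRVertex n) : SRexp n (Finsupp.single S 1) = SRind n S := by
  simp [SRexp]

/-- The support of the monomial is a chain -/
def SRchain (n : ℕ) (m : SRVertex n →₀ ℕ) : Prop :=
  ∀ S ∈ m.support, ∀ T ∈ m.support, S.1 ⊆ T.1 ∨ T.1 ⊆ S.1

lemma SRexp_ne_zero (n : ℕ) (m : SRVertex n →₀ ℕ) (i : Fin n) :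
    SRexp n m i ≠ 0 ↔ ∃ S ∈ m.support, i ∈ S.1 := by
  rw [SRexp, Finsupp.linearCombination_apply, Finsupp.sum, Finsupp.finset_sum_apply, Ne,
    Finset.sum_eq_zero_iff]
  simp only [Finsupp.smul_apply, SRind_apply]
  push Not
  refine exists_congr fun S => and_congr_right fun hS => ?_
  have := Finsupp.mem_support_iff.1 hS
  simp [this]

lemma SRexp_eq_zero (n : ℕ) (m : SRVertex n →₀ ℕ) (h : SRexp n m = 0) : m = 0 := by
  by_contra hm
  obtain ⟨S, hS⟩ := Finsupp.support_nonempty_iff.2 hm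
  obtain ⟨i, hi⟩ := S.2
  exact (SRexp_ne_zero n m i).2 ⟨S, hS, hi⟩ (by simp [h])

lemma SRexp_top (n : ℕ) (m : SRVertex n →₀ ℕ) (hc : SRchain n m) (h : SRexp n m ≠ 0) :
    ∃ S ∈ m.support, S.1 = (SRexp n m).support := by
  have hm : m ≠ 0 := by rintro rfl; simp at h
  obtain ⟨S, hS, hmax⟩ := Finset.exists_max_image m.support (fun S => S.1.card)
    (Finsupp.support_nonempty_iff.2 hm)
  refine ⟨S, hS, ?_⟩
  ext i
  rw [Finsupp.mem_support_iff, SRexp_ne_zero]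
  constructor
  · intro hi; exact ⟨S, hS, hi⟩
  · rintro ⟨T, hT, hi⟩
    rcases hc T hT S hS with h1 | h1
    · exact h1 hi
    · rw [Finset.eq_of_subset_of_card_le h1 (hmax T hT)]; exact hi

lemma SRchain_mono (n : ℕ) {m m' : SRVertex n →₀ ℕ} (h : m' ≤ m) (hc : SRchain n m) :
    SRchain n m' := fun S hS T hT =>
  hc S (Finsupp.support_mono h hS) T (Finsupp.support_mono h hT)

lemma SRind_degree (n : ℕ) (S : SRVertex n) : (SRind n S).degree = S.1.card := by
  simp [SRind]

lemma SRexp_degree (n : ℕ) (m : SRVertex n →₀ ℕ) :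
    (SRexp n m).degree = Finsupp.weight (fun S : SRVertex n => S.1.card) m := by
  induction m using Finsupp.induction_linear with
  | zero => simp
  | add f g hf hg => simp [hf, hg]
  | single S c => simp [SRexp, SRind_degree, Finsupp.weight_apply]

lemma SRexp_inj (n : ℕ) : ∀ (N : ℕ) (m m' : SRVertex n →₀ ℕ), (SRexp n m).degree < N →
    SRchain n m → SRchain n m' → SRexp n m = SRexp n m' → m = m' := by
  intro N
  induction N with
  | zero => intro m m' h; simp at h
  | succ N ih =>
    intro m m' hN hc hc' he
    by_cases h0 : SRexp n m = 0
    · rw [SRexp_eq_zero n m h0, SRexp_eq_zero n m' (he ▸ h0)]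
    · obtain ⟨S, hS, hS'⟩ := SRexp_top n m hc h0
      obtain ⟨T, hT, hT'⟩ := SRexp_top n m' hc' (he ▸ h0)
      have hST : T = S := Subtype.ext (by rw [hT', hS', he])
      subst hST
      have h1 : Finsupp.single T 1 ≤ m := by
        rw [Finsupp.single_le_iff]
        exact Nat.one_le_iff_ne_zero.2 (Finsupp.mem_support_iff.1 hS)
      have h2 : Finsupp.single T 1 ≤ m' := by
        rw [Finsupp.single_le_iff]
        exact Nat.one_le_iff_ne_zero.2 (Finsupp.mem_support_iff.1 hT)
      obtain ⟨a, rfl⟩ := exists_add_of_le h1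
      obtain ⟨b, rfl⟩ := exists_add_of_le h2
      rw [map_add, map_add] at he
      rw [map_add, map_add, SRexp_single, SRind_degree] at hN
      have := T.2.card_pos
      rw [ih a b (by omega) (SRchain_mono n le_add_self hc) (SRchain_mono n le_add_self hc')
        (add_left_cancel he)]

lemma SRexp_surj (n : ℕ) : ∀ (N : ℕ) (a : Fin n →₀ ℕ), a.degree < N →
    ∃ m, SRchain n m ∧ SRexp n m = a := by
  intro N
  induction N with
  | zero => intro a h; simp at h
  | succ N ih =>
    intro a hN
    by_cases h0 : a = 0
    · exact ⟨0, by intro S hS; simp at hS, by simp [h0]⟩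
    · let S : SRVertex n := ⟨a.support, Finsupp.support_nonempty_iff.2 h0⟩
      have h1 : SRind n S ≤ a := by
        intro i
        rw [SRind_apply]
        split_ifs with hi
        · exact Nat.one_le_iff_ne_zero.2 (Finsupp.mem_support_iff.1 hi)
        · simp
      obtain ⟨b, hb⟩ := exists_add_of_le h1
      have hd : a.degree = S.1.card + b.degree := by
        rw [← SRind_degree, ← map_add, ← hb]
      have := S.2.card_pos
      obtain ⟨m, hc, hm⟩ := ih b (by omega)
      have key : ∀ T ∈ m.support, T.1 ⊆ S.1 := by
        intro T hT i hi
        have h3 := (SRexp_ne_zero n m i).2 ⟨T, hT, hi⟩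
        rw [hm] at h3
        show i ∈ a.support
        rw [Finsupp.mem_support_iff, hb, Finsupp.add_apply]
        omega
      refine ⟨Finsupp.single S 1 + m, ?_, by rw [map_add, SRexp_single, hm, ← hb]⟩
      have hsup : ∀ T ∈ (Finsupp.single S 1 + m).support, T = S ∨ T ∈ m.support := by
        intro T hT
        rcases Finset.mem_union.1 (Finsupp.support_add hT) with h | h
        · left; exact Finset.mem_singleton.1 (Finsupp.support_single_subset h)
        · exact Or.inr h
      intro T hT U hU
      rcases hsup T hT with rfl | hT' <;> rcases hsup U hU with rfl | hU'
      · exact Or.inl subset_rfl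
      · exact Or.inr (key U hU')
      · exact Or.inl (key T hT')
      · exact hc T hT' U hU'

/-- inverse of `SRexp` on chains -/
noncomputable def SRlev (n : ℕ) (a : Fin n →₀ ℕ) : SRVertex n →₀ ℕ :=
  (SRexp_surj n (a.degree + 1) a (Nat.lt_succ_self _)).choose

lemma SRlev_chain (n : ℕ) (a : Fin n →₀ ℕ) : SRchain n (SRlev n a) :=
  (SRexp_surj n (a.degree + 1) a (Nat.lt_succ_self _)).choose_spec.1

lemma SRexp_lev (n : ℕ) (a : Fin n →₀ ℕ) : SRexp n (SRlev n a) = a :=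
  (SRexp_surj n (a.degree + 1) a (Nat.lt_succ_self _)).choose_spec.2

lemma SRlev_unique (n : ℕ) (m : SRVertex n →₀ ℕ) (a : Fin n →₀ ℕ) (hc : SRchain n m)
    (h : SRexp n m = a) : SRlev n a = m :=
  SRexp_inj n _ _ _ (Nat.lt_succ_self _) (SRlev_chain n a) hc (by rw [SRexp_lev, h])

lemma SRexp_mapDomain (n : ℕ) (g : Equiv.Perm (Fin n)) (m : SRVertex n →₀ ℕ) :
    SRexp n (m.mapDomain (SRpermVertex n g)) = (SRexp n m).mapDomain g := by
  induction m using Finsupp.induction_linear with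
  | zero => simp
  | add f h hf hg => simp [Finsupp.mapDomain_add, hf, hg]
  | single S c =>
    rw [Finsupp.mapDomain_single, SRexp, Finsupp.linearCombination_single,
      Finsupp.linearCombination_single, Finsupp.mapDomain_smul]
    congr 1
    simp only [SRind, SRpermVertex, Finsupp.mapDomain_finset_sum, Finsupp.mapDomain_single]
    rw [Finset.sum_image (fun _ _ _ _ h => g.injective h)]

lemma SRlev_mapDomain (n : ℕ) (g : Equiv.Perm (Fin n)) (a : Fin n →₀ ℕ) :
    SRlev n (a.mapDomain g) = (SRlev n a).mapDomain (SRpermVertex n g) := by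
  classical
  apply SRlev_unique
  · intro S hS T hT
    obtain ⟨S', hS', rfl⟩ := Finset.mem_image.1 (Finsupp.mapDomain_support hS)
    obtain ⟨T', hT', rfl⟩ := Finset.mem_image.1 (Finsupp.mapDomain_support hT)
    exact (SRlev_chain n a S' hS' T' hT').imp (fun h => Finset.image_subset_image h)
      (fun h => Finset.image_subset_image h)
  · rw [SRexp_mapDomain, SRexp_lev]

open Classical in
/-- `y^m ↦ x^(exp m)` on chains, `0` otherwise -/
noncomputable def SRphi (n : ℕ) (k : Type) [Field k] :
    MvPolynomial (SRVertex n) k →ₗ[k] MvPolynomial (Fin n) k :=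
  (MvPolynomial.basisMonomials (SRVertex n) k).constr k
    (fun m => if SRchain n m then MvPolynomial.monomial (SRexp n m) 1 else 0)

open Classical in
lemma SRphi_monomial (n : ℕ) (k : Type) [Field k] (m : SRVertex n →₀ ℕ) (c : k) :
    SRphi n k (MvPolynomial.monomial m c) =
      if SRchain n m then MvPolynomial.monomial (SRexp n m) c else 0 := by
  have h := (MvPolynomial.basisMonomials (SRVertex n) k).constr_basis k
    (fun m => if SRchain n m then MvPolynomial.monomial (SRexp n m) (1 : k) else 0) m
  rw [MvPolynomial.coe_basisMonomials] at h
  have h2 : (MvPolynomial.monomial m c : MvPolynomial (SRVertex n) k)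
      = c • MvPolynomial.monomial m 1 := by simp [MvPolynomial.smul_monomial]
  rw [h2, map_smul, SRphi, h]
  split_ifs <;> simp [MvPolynomial.smul_monomial]

/-- `x^a ↦ y^(lev a)` -/
noncomputable def SRpsi (n : ℕ) (k : Type) [Field k] :
    MvPolynomial (Fin n) k →ₗ[k] MvPolynomial (SRVertex n) k :=
  (MvPolynomial.basisMonomials (Fin n) k).constr k
    (fun a => MvPolynomial.monomial (SRlev n a) 1)

lemma SRpsi_monomial (n : ℕ) (k : Type) [Field k] (a : Fin n →₀ ℕ) (c : k) :
    SRpsi n k (MvPolynomial.monomial a c) = MvPolynomial.monomial (SRlev n a) c := by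
  have h := (MvPolynomial.basisMonomials (Fin n) k).constr_basis k
    (fun a => MvPolynomial.monomial (SRlev n a) (1 : k)) a
  rw [MvPolynomial.coe_basisMonomials] at h
  have h2 : (MvPolynomial.monomial a c : MvPolynomial (Fin n) k)
      = c • MvPolynomial.monomial a 1 := by simp [MvPolynomial.smul_monomial]
  rw [h2, map_smul, SRpsi, h]
  simp [MvPolynomial.smul_monomial]

lemma SRphi_psi (n : ℕ) (k : Type) [Field k] (p : MvPolynomial (Fin n) k) :
    SRphi n k (SRpsi n k p) = p := by
  induction p using MvPolynomial.induction_on' with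
  | monomial a c => rw [SRpsi_monomial, SRphi_monomial, if_pos (SRlev_chain n a), SRexp_lev]
  | add p q hp hq => rw [map_add, map_add, hp, hq]

lemma SRphi_ideal (n : ℕ) (k : Type) [Field k] (p : MvPolynomial (SRVertex n) k)
    (hp : p ∈ SRIdeal n k) : SRphi n k p = 0 := by
  suffices h : ∀ a, SRphi n k (a * p) = 0 by simpa using h 1
  rw [SRIdeal] at hp
  induction hp using Submodule.span_induction with
  | zero => simp
  | add x y _ _ hx hy => intro a; rw [mul_add, map_add, hx, hy, add_zero]
  | smul b x _ hx => intro a; rw [smul_eq_mul, ← mul_assoc]; exact hx _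
  | mem x hx =>
    obtain ⟨S, T, hST, hTS, rfl⟩ := hx
    intro a
    induction a using MvPolynomial.induction_on' with
    | add p q hp hq => rw [add_mul, map_add, hp, hq, add_zero]
    | monomial m c =>
      rw [MvPolynomial.X, MvPolynomial.X, MvPolynomial.monomial_mul, MvPolynomial.monomial_mul,
        SRphi_monomial, if_neg]
      intro hc
      rcases hc S (by simp) T (by simp) with h | h
      · exact hST h
      · exact hTS h

lemma SRmonomial_mem (n : ℕ) (k : Type) [Field k] (m : SRVertex n →₀ ℕ) (c : k)
    (hc : ¬ SRchain n m) : MvPolynomial.monomial m c ∈ SRIdeal n k := by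
  unfold SRchain at hc
  push Not at hc
  obtain ⟨S, hS, T, hT, hST, hTS⟩ := hc
  have hne : S ≠ T := by rintro rfl; exact hST subset_rfl
  have hle : Finsupp.single S 1 + Finsupp.single T 1 ≤ m := by
    intro U
    have h1 := Finsupp.mem_support_iff.1 hS
    have h2 := Finsupp.mem_support_iff.1 hT
    classical
    rw [Finsupp.add_apply, Finsupp.single_apply, Finsupp.single_apply]
    split_ifs with ha hb hb
    · exact absurd (ha.trans hb.symm) hne
    · subst ha; omega
    · subst hb; omega
    · simp
  obtain ⟨b, rfl⟩ := exists_add_of_le hle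
  have : (MvPolynomial.monomial (Finsupp.single S 1 + Finsupp.single T 1 + b) c :
      MvPolynomial (SRVertex n) k) =
      MvPolynomial.monomial b c * (MvPolynomial.X S * MvPolynomial.X T) := by
    rw [MvPolynomial.X, MvPolynomial.X, MvPolynomial.monomial_mul, MvPolynomial.monomial_mul,
      add_comm b]
    simp
  rw [this]
  exact Ideal.mul_mem_left _ _ (Ideal.subset_span ⟨S, T, hST, hTS, rfl⟩)

lemma SRpsi_phi (n : ℕ) (k : Type) [Field k] (p : MvPolynomial (SRVertex n) k) :
    SRpsi n k (SRphi n k p) - p ∈ SRIdeal n k := by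
  induction p using MvPolynomial.induction_on' with
  | add p q hp hq =>
    rw [map_add, map_add, add_sub_add_comm]
    exact Ideal.add_mem _ hp hq
  | monomial m c =>
    rw [SRphi_monomial]
    split_ifs with h
    · rw [SRpsi_monomial, SRlev_unique n m _ h rfl, sub_self]; exact zero_mem _
    · rw [map_zero, zero_sub]; exact neg_mem (SRmonomial_mem n k m c h)

/-- the linear map `k[x] → R` -/
noncomputable def SRPsi (n : ℕ) (k : Type) [Field k] :
    MvPolynomial (Fin n) k →ₗ[k] SRRing n k :=
  (Ideal.Quotient.mkₐ k (SRIdeal n k)).toLinearMap ∘ₗ SRpsi n k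

lemma SRPsi_apply (n : ℕ) (k : Type) [Field k] (p : MvPolynomial (Fin n) k) :
    SRPsi n k p = Ideal.Quotient.mk (SRIdeal n k) (SRpsi n k p) := rfl

lemma SRPsi_phi (n : ℕ) (k : Type) [Field k] (p : MvPolynomial (SRVertex n) k) :
    SRPsi n k (SRphi n k p) = Ideal.Quotient.mk (SRIdeal n k) p := by
  rw [SRPsi_apply, Ideal.Quotient.eq]
  exact SRpsi_phi n k p

lemma SRPsi_bij (n : ℕ) (k : Type) [Field k] : Function.Bijective (SRPsi n k) := by
  constructor
  · rw [injective_iff_map_eq_zero]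
    intro p hp
    rw [SRPsi_apply, Ideal.Quotient.eq_zero_iff_mem] at hp
    rw [← SRphi_psi n k p, SRphi_ideal n k _ hp]
  · intro r
    obtain ⟨p, rfl⟩ := Ideal.Quotient.mk_surjective r
    exact ⟨_, SRPsi_phi n k p⟩

lemma SRPsi_equivariant (n : ℕ) (k : Type) [Field k] (g : Equiv.Perm (Fin n))
    (p : MvPolynomial (Fin n) k) :
    SRmap n k g (SRPsi n k p) = SRPsi n k (MvPolynomial.rename g p) := by
  induction p using MvPolynomial.induction_on' with
  | add p q hp hq => simp only [map_add, hp, hq]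
  | monomial a c =>
    rw [SRPsi_apply, SRPsi_apply, SRmap, Ideal.quotientMap_mk, SRpsi_monomial,
      MvPolynomial.rename_monomial, SRpsi_monomial, SRlev_mapDomain]
    congr 1
    exact MvPolynomial.rename_monomial _ _ _

lemma SRmem_of_weighted {σ k M : Type} [Field k] [AddCommGroup M] [Module k M]
    (L : MvPolynomial σ k →ₗ[k] M) (N : Submodule k M) (w : σ → ℕ) (d : ℕ)
    (h : ∀ m c, Finsupp.weight w m = d → L (MvPolynomial.monomial m c) ∈ N)
    (p : MvPolynomial σ k) (hp : MvPolynomial.IsWeightedHomogeneous w p d) : L p ∈ N := by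
  rw [p.as_sum, map_sum]
  exact Submodule.sum_mem _ fun m hm => h _ _ (hp (MvPolynomial.mem_support_iff.1 hm))

lemma SRPsi_map_hom (n : ℕ) (k : Type) [Field k] (d : ℕ) :
    (MvPolynomial.homogeneousSubmodule (Fin n) k d).map (SRPsi n k) = SRdegComponent n k d := by
  apply le_antisymm
  · rintro _ ⟨p, hp, rfl⟩
    refine ⟨SRpsi n k p, ?_, rfl⟩
    refine SRmem_of_weighted (SRpsi n k) _ 1 d ?_ p hp
    intro m c hm
    rw [SRpsi_monomial, MvPolynomial.mem_weightedHomogeneousSubmodule]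
    apply MvPolynomial.isWeightedHomogeneous_monomial
    rw [← SRexp_degree, SRexp_lev, Finsupp.degree_eq_weight_one]
    exact hm
  · rintro _ ⟨p, hp, rfl⟩
    refine ⟨SRphi n k p, ?_, SRPsi_phi n k p⟩
    refine SRmem_of_weighted (SRphi n k) _ _ d ?_ p hp
    intro m c hm
    rw [SRphi_monomial]
    split_ifs with h
    · rw [MvPolynomial.mem_homogeneousSubmodule]
      apply MvPolynomial.isHomogeneous_monomial
      rw [SRexp_degree, hm]
    · exact zero_mem _

lemma SRPsi_map_fixed (n : ℕ) (k : Type) [Field k] (G : Subgroup (Equiv.Perm (Fin n))) :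
    (polyFixedSubmodule n k G).map (SRPsi n k) = SRfixedSubmodule n k G := by
  apply le_antisymm
  · rintro _ ⟨p, hp, rfl⟩ g hg
    rw [SRPsi_equivariant, hp g hg]
  · intro r hr
    obtain ⟨p, rfl⟩ := (SRPsi_bij n k).2 r
    refine ⟨p, fun g hg => (SRPsi_bij n k).1 ?_, rfl⟩
    rw [← SRPsi_equivariant]
    exact hr g hg

/-- Equality of Hilbert series: for each degree `d`, the space of `G`-fixed
elements of the degree-`d` component of the Stanley–Reisner ring of `B_n`
minus its bottom element has the same finite `k`-dimension as the space of
`G`-fixed homogeneous polynomials of degree `d` in `k[x_1,…,x_n]`. -/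
theorem SRinvariant_hilbert_series_eq (n : ℕ) (hn : 1 ≤ n) (k : Type) [Field k]
    (G : Subgroup (Equiv.Perm (Fin n))) (d : ℕ) :
    FiniteDimensional k ↥(SRdegComponent n k d ⊓ SRfixedSubmodule n k G) ∧
    FiniteDimensional k
      ↥(MvPolynomial.homogeneousSubmodule (Fin n) k d ⊓ polyFixedSubmodule n k G) ∧
    Module.finrank k ↥(SRdegComponent n k d ⊓ SRfixedSubmodule n k G) =
      Module.finrank k
        ↥(MvPolynomial.homogeneousSubmodule (Fin n) k d ⊓ polyFixedSubmodule n k G) := by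

  have hmap : SRdegComponent n k d ⊓ SRfixedSubmodule n k G =
      (MvPolynomial.homogeneousSubmodule (Fin n) k d ⊓ polyFixedSubmodule n k G).map
        (SRPsi n k) := by
    rw [Submodule.map_inf _ (SRPsi_bij n k).1, SRPsi_map_hom, SRPsi_map_fixed]
  have hfin : FiniteDimensional k
      ↥(MvPolynomial.homogeneousSubmodule (Fin n) k d ⊓ polyFixedSubmodule n k G) := by
    have : FiniteDimensional k ↥(MvPolynomial.homogeneousSubmodule (Fin n) k d) :=
      Module.Finite.iff_fg.2 (MvPolynomial.homogeneousSubmodule_fg _ _ d)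
    exact Submodule.finiteDimensional_of_le inf_le_left
  have e := Submodule.equivMapOfInjective (SRPsi n k) (SRPsi_bij n k).1
    (MvPolynomial.homogeneousSubmodule (Fin n) k d ⊓ polyFixedSubmodule n k G)
  rw [hmap]
  exact ⟨Module.Finite.equiv e, hfin, e.finrank_eq.symm⟩
end
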